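/- arXiv:math/0212150 — 2 statements merged into one kernel-verified Lean document; each statement's English description precedes it below -/
import Mathlib

section
/- Let α = (a_1, …, a_r) ∈ (B_n)^r and let β ∈ C^{inf}(α). Then there exists a finite chain of tuples α = α_1, α_2, …, α_{k+1} = β, all lying in C^{inf}(α), and simple elements s_1, …, s_k such that s_j^{-1} α_j s_j = α_{j+1} (conjugation applied to every entry simultaneously) for every j = 1, …, k. -/
/-- The braid relations on `n` strands, with Artin generators indexed by `Fin (n-1)`:
`σᵢ σⱼ σᵢ = σⱼ σᵢ σⱼ` when `|i - j| = 1`, and `σᵢ σⱼ = σⱼ σᵢ` when `|i - j| ≥ 2`. -/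
def braidRels (n : ℕ) : Set (FreeGroup (Fin (n - 1))) :=
  {w | (∃ i j : Fin (n - 1), (i : ℕ) + 1 = (j : ℕ) ∧
          w = FreeGroup.of i * FreeGroup.of j * FreeGroup.of i *
              (FreeGroup.of j * FreeGroup.of i * FreeGroup.of j)⁻¹) ∨
       (∃ i j : Fin (n - 1), (i : ℕ) + 1 < (j : ℕ) ∧
          w = FreeGroup.of i * FreeGroup.of j * (FreeGroup.of j * FreeGroup.of i)⁻¹)}

/-- The braid group `B_n` on `n` strands. -/
abbrev BraidGroup (n : ℕ) := PresentedGroup (braidRels n)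

/-- The Artin generator `σᵢ` of the braid group. -/
def braidGen (n : ℕ) (i : Fin (n - 1)) : BraidGroup n := PresentedGroup.of i

/-- The monoid `B_n⁺` of positive braids: products of the generators with no inverses. -/
def PosBraid (n : ℕ) : Submonoid (BraidGroup n) :=
  Submonoid.closure (Set.range (braidGen n))

/-- Prefix order (left-divisibility): `a ≼ b` iff `a * c = b` for some positive `c`. -/
def PrefixLE (n : ℕ) (a b : BraidGroup n) : Prop :=
  ∃ c ∈ PosBraid n, a * c = b

/-- The Garside half-twist `Δ = (σ₁)(σ₂σ₁)⋯(σ_{n-1}⋯σ₁)`. -/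
def braidDelta (n : ℕ) : BraidGroup n :=
  ((List.finRange (n - 1)).map (fun k =>
      ((((List.finRange (n - 1)).filter (fun i => decide (i ≤ k))).reverse.map
        (braidGen n)).prod))).prod

/-- A simple element (permutation braid): a positive braid left-dividing `Δ`. -/
def IsSimple (n : ℕ) (s : BraidGroup n) : Prop :=
  s ∈ PosBraid n ∧ PrefixLE n s (braidDelta n)

/-- `InfGE n j a` means `inf(a) ≥ j`, i.e. `a = Δ^j p` for some positive braid `p`. -/
def InfGE (n : ℕ) (j : ℤ) (a : BraidGroup n) : Prop :=
  ∃ p ∈ PosBraid n, a = braidDelta n ^ j * p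

/-- `β ∈ C^inf(α)`: `inf(β i) ≥ inf(α i)` for all `i` and `β` is simultaneously
conjugate to `α`. -/
def CInf (n r : ℕ) (α β : Fin r → BraidGroup n) : Prop :=
  (∀ i, ∀ j : ℤ, InfGE n j (α i) → InfGE n j (β i)) ∧
  ∃ ω : BraidGroup n, ∀ i, β i = ω⁻¹ * α i * ω

/-- `δ ∈ C_J`: `inf(δ i) ≥ J i` for all `i`. -/
def CJ (n r : ℕ) (J : Fin r → ℤ) (δ : Fin r → BraidGroup n) : Prop :=
  ∀ i, InfGE n (J i) (δ i)

/-- Property `P(δ,J)` for a braid `s`: `inf(s⁻¹ δᵢ s) ≥ J i` for all `i`,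
i.e. `s⁻¹ δ s ∈ C_J`. -/
def PropP (n r : ℕ) (J : Fin r → ℤ) (δ : Fin r → BraidGroup n) (s : BraidGroup n) : Prop :=
  ∀ i, InfGE n (J i) (s⁻¹ * δ i * s)

/-- `s ∈ S_{δ,J}`: `s` is ≼-minimal among the nontrivial simple elements
satisfying `P(δ,J)`. -/
def MinSimple (n r : ℕ) (J : Fin r → ℤ) (δ : Fin r → BraidGroup n) (s : BraidGroup n) : Prop :=
  IsSimple n s ∧ s ≠ 1 ∧ PropP n r J δ s ∧
    ∀ t : BraidGroup n, IsSimple n t → t ≠ 1 → PropP n r J δ t → PrefixLE n t s → t = s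

/-- `d` is a greatest common left-divisor of `u` and `v` in `B_n⁺`. -/
def IsGCD (n : ℕ) (u v d : BraidGroup n) : Prop :=
  d ∈ PosBraid n ∧ PrefixLE n d u ∧ PrefixLE n d v ∧
    ∀ c ∈ PosBraid n, PrefixLE n c u → PrefixLE n c v → PrefixLE n c d

/-- `m` is a least common left-multiple of `u` and `v` in `B_n⁺`. -/
def IsLCM (n : ℕ) (u v m : BraidGroup n) : Prop :=
  m ∈ PosBraid n ∧ PrefixLE n u m ∧ PrefixLE n v m ∧
    ∀ c ∈ PosBraid n, PrefixLE n u c → PrefixLE n v c → PrefixLE n m c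

/-- The defining relations of the Artin monoid attached to a graph `adj` all of whose edges carry
the label `3`. -/
inductive ArtinRel {I : Type*} (adj : I → I → Prop) : FreeMonoid I → FreeMonoid I → Prop
  | braid {i j : I} (h : adj i j) : ArtinRel adj
      (FreeMonoid.of i * FreeMonoid.of j * FreeMonoid.of i)
      (FreeMonoid.of j * FreeMonoid.of i * FreeMonoid.of j)
  | comm {i j : I} (hne : i ≠ j) (h : ¬ adj i j) : ArtinRel adj
      (FreeMonoid.of i * FreeMonoid.of j) (FreeMonoid.of j * FreeMonoid.of i)

/-- The Artin monoid of a graph. -/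
abbrev ArtinMonoid {I : Type*} (adj : I → I → Prop) := PresentedMonoid (ArtinRel adj)

namespace ArtinMonoid

variable {I : Type*} {adj : I → I → Prop}

/-- The generators of the Artin monoid. -/
def gen (adj : I → I → Prop) (i : I) : ArtinMonoid adj := PresentedMonoid.of _ i

/-- The word length, as a monoid homomorphism. -/
def lenHom (adj : I → I → Prop) : ArtinMonoid adj →* Multiplicative ℕ :=
  PresentedMonoid.lift (fun _ => Multiplicative.ofAdd 1) <| by
    rintro _ _ (_ | _) <;> simp

/-- The word length of an element of the Artin monoid. -/
def len (x : ArtinMonoid adj) : ℕ := (lenHom adj x).toAdd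

@[simp] theorem len_one : len (1 : ArtinMonoid adj) = 0 := by simp [len]

@[simp] theorem len_mul (x y : ArtinMonoid adj) : len (x * y) = len x + len y := by simp [len]

@[simp] theorem len_gen (i : I) : len (gen adj i) = 1 := rfl

theorem braid_mul {i j : I} (h : adj i j) (x : ArtinMonoid adj) :
    gen adj i * (gen adj j * (gen adj i * x)) = gen adj j * (gen adj i * (gen adj j * x)) := by
  have := PresentedMonoid.mk_eq_mk_of_rel (ArtinRel.braid h)
  simp only [map_mul] at this
  simpa only [mul_assoc, gen, PresentedMonoid.of] using congrArg (· * x) this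

theorem comm_mul {i j : I} (hne : i ≠ j) (h : ¬ adj i j) (x : ArtinMonoid adj) :
    gen adj i * (gen adj j * x) = gen adj j * (gen adj i * x) := by
  have := PresentedMonoid.mk_eq_mk_of_rel (ArtinRel.comm hne h)
  simp only [map_mul] at this
  simpa only [mul_assoc, gen, PresentedMonoid.of] using congrArg (· * x) this

theorem eq_one_or_exists_gen_mul (x : ArtinMonoid adj) : x = 1 ∨ ∃ i y, x = gen adj i * y := by
  obtain ⟨w, rfl⟩ := PresentedMonoid.surjective_mk x
  induction w using FreeMonoid.casesOn with
  | one => exact .inl rfl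
  | of_mul i w => exact .inr ⟨i, PresentedMonoid.mk _ w, rfl⟩

theorem len_eq_zero {x : ArtinMonoid adj} : len x = 0 ↔ x = 1 := by
  refine ⟨fun h => ?_, fun h => by simp [h]⟩
  rcases eq_one_or_exists_gen_mul x with rfl | ⟨i, y, rfl⟩
  · rfl
  · simp at h

/-- The solutions of `gen i * x = gen j * y` which factor through the least common multiple of the
two generators. -/
def Residual (i j : I) (x y : ArtinMonoid adj) : Prop :=
  (i = j ∧ x = y) ∨
  (adj i j ∧ ∃ c, x = gen adj j * (gen adj i * c) ∧ y = gen adj i * (gen adj j * c)) ∨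
  (i ≠ j ∧ ¬ adj i j ∧ ∃ c, x = gen adj j * c ∧ y = gen adj i * c)

theorem Residual.symm (hs : ∀ i j, adj i j → adj j i) {i j : I} {x y : ArtinMonoid adj}
    (h : Residual i j x y) : Residual j i y x := by
  rcases h with ⟨rfl, rfl⟩ | ⟨h, c, rfl, rfl⟩ | ⟨hne, h, c, rfl, rfl⟩
  · exact .inl ⟨rfl, rfl⟩
  · exact .inr (.inl ⟨hs _ _ h, c, rfl, rfl⟩)
  · exact .inr (.inr ⟨hne.symm, fun h' => h (hs _ _ h'), c, rfl, rfl⟩)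

theorem Residual.mul_right {i j : I} {x y : ArtinMonoid adj} (h : Residual i j x y)
    (z : ArtinMonoid adj) : Residual i j (x * z) (y * z) := by
  rcases h with ⟨rfl, rfl⟩ | ⟨h, c, rfl, rfl⟩ | ⟨hne, h, c, rfl, rfl⟩
  · exact .inl ⟨rfl, rfl⟩
  · exact .inr (.inl ⟨h, c * z, by simp only [mul_assoc], by simp only [mul_assoc]⟩)
  · exact .inr (.inr ⟨hne, h, c * z, by simp only [mul_assoc], by simp only [mul_assoc]⟩)

/-- Every solution of `gen i * x = gen j * y` with `len x < N` factors through the least common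
multiple of the two generators. -/
def ResolvesBelow (adj : I → I → Prop) (N : ℕ) : Prop :=
  ∀ (i j : I) (x y : ArtinMonoid adj), len x < N → gen adj i * x = gen adj j * y → Residual i j x y

namespace ResolvesBelow

variable {N : ℕ} (hK : ResolvesBelow adj N)
include hK

theorem cancel {i : I} (hirr : ¬ adj i i) {x y : ArtinMonoid adj} (hx : len x < N)
    (h : gen adj i * x = gen adj i * y) : x = y := by
  rcases hK i i x y hx h with ⟨_, h⟩ | ⟨h, _⟩ | ⟨h, _⟩
  · exact h
  · exact absurd h hirr
  · exact absurd rfl h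

theorem of_adj (hirr : ∀ i, ¬ adj i i) {i j : I} (hij : adj i j) {x y : ArtinMonoid adj}
    (hx : len x < N) (h : gen adj i * x = gen adj j * y) :
    ∃ c, x = gen adj j * (gen adj i * c) ∧ y = gen adj i * (gen adj j * c) := by
  rcases hK i j x y hx h with ⟨rfl, _⟩ | ⟨_, h⟩ | ⟨_, h, _⟩
  · exact absurd hij (hirr _)
  · exact h
  · exact absurd hij h

theorem of_not_adj {i j : I} (hne : i ≠ j) (hij : ¬ adj i j) {x y : ArtinMonoid adj}
    (hx : len x < N) (h : gen adj i * x = gen adj j * y) :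
    ∃ c, x = gen adj j * c ∧ y = gen adj i * c := by
  rcases hK i j x y hx h with ⟨rfl, _⟩ | ⟨h, _⟩ | ⟨_, _, h⟩
  · exact absurd rfl hne
  · exact absurd h hij
  · exact h

theorem trans_adj_not_adj (hs : ∀ i j, adj i j → adj j i) (hirr : ∀ i, ¬ adj i i) {i j k : I}
    {c d : ArtinMonoid adj} (hik : adj i k) (hne : k ≠ j) (hkj : ¬ adj k j)
    (hlen : len (gen adj i * (gen adj k * c)) ≤ N)
    (h : gen adj i * (gen adj k * c) = gen adj j * d) :
    Residual i j (gen adj k * (gen adj i * c)) (gen adj k * d) := by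
  have hne' : i ≠ j := by rintro rfl; exact hkj (hs _ _ hik)
  simp only [len_mul, len_gen] at hlen
  by_cases hij : adj i j
  · obtain ⟨e, he, rfl⟩ := hK.of_adj hirr hij (by simp; omega) h
    obtain ⟨q', rfl, hq⟩ := hK.of_not_adj hne hkj (by omega) he
    have hl := congrArg len he
    simp only [len_mul, len_gen] at hl hlen
    obtain ⟨q, rfl, rfl⟩ := hK.of_adj hirr hik (by omega) hq
    refine .inr (.inl ⟨hij, gen adj k * (gen adj i * (gen adj j * q)), ?_, ?_⟩)
    · rw [braid_mul hij, comm_mul hne hkj, ← comm_mul hne hkj q, ← braid_mul hik]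
    · rw [← comm_mul hne hkj, ← braid_mul hik, braid_mul hij q, comm_mul hne hkj]
  · obtain ⟨e, he, rfl⟩ := hK.of_not_adj hne' hij (by simp; omega) h
    obtain ⟨q, rfl, rfl⟩ := hK.of_not_adj hne hkj (by omega) he
    refine .inr (.inr ⟨hne', hij, gen adj k * (gen adj i * q), ?_, ?_⟩)
    · rw [comm_mul hne' hij, comm_mul hne hkj]
    · rw [braid_mul hik]

theorem residual_trans (hs : ∀ i j, adj i j → adj j i) (hirr : ∀ i, ¬ adj i i)
    (htri : ∀ i j k, adj i j → adj j k → ¬ adj i k) {i j k : I} {x y z : ArtinMonoid adj}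
    (hz : len z ≤ N) (h₁ : Residual i k x z) (h₂ : Residual k j z y) : Residual i j x y := by
  rcases h₁ with ⟨rfl, rfl⟩ | ⟨hik, c, rfl, rfl⟩ | ⟨hne, hik, c, rfl, rfl⟩
  · exact h₂
  · rcases h₂ with ⟨rfl, rfl⟩ | ⟨hkj, d, hd, rfl⟩ | ⟨hne', hkj, d, hd, rfl⟩
    · exact .inr (.inl ⟨hik, c, rfl, rfl⟩)
    · simp only [len_mul, len_gen] at hz
      by_cases hij : i = j
      · subst hij
        rw [hK.cancel (hirr _) (by omega) (hK.cancel (hirr _) (by simp; omega) hd)]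
        exact .inl ⟨rfl, rfl⟩
      · have hnadj := htri _ _ _ hik hkj
        obtain ⟨e, he, he'⟩ := hK.of_not_adj hij hnadj (by simp; omega) hd
        have hl := congrArg len he
        have hl' := congrArg len he'
        have hl'' := congrArg len hd
        simp only [len_mul, len_gen] at hl hl' hl''
        obtain ⟨p, rfl, rfl⟩ := hK.of_adj hirr hkj (by omega) he
        obtain ⟨q, rfl, hq⟩ := hK.of_adj hirr (hs _ _ hik) (by omega) he'
        simp only [len_mul, len_gen] at hl hl' hl'' hz
        obtain ⟨r, rfl, rfl⟩ := hK.of_not_adj (Ne.symm hij) (fun h => hnadj (hs _ _ h))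
          (by omega) (hK.cancel (hirr _) (by simp; omega) hq)
        refine .inr (.inr ⟨hij, hnadj, gen adj k * (gen adj j * (gen adj i * (gen adj k * r))),
          ?_, ?_⟩)
        · rw [comm_mul hij hnadj, braid_mul hik, braid_mul hkj]
        · rw [← comm_mul hij hnadj, ← braid_mul hkj, ← braid_mul hik]
          rw [← comm_mul hij hnadj (_ * _)]
    · exact hK.trans_adj_not_adj hs hirr hik hne' hkj hz hd
  · rcases h₂ with ⟨rfl, rfl⟩ | ⟨hkj, d, hd, rfl⟩ | ⟨hne', hkj, d, hd, rfl⟩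
    · exact .inr (.inr ⟨hne, hik, c, rfl, rfl⟩)
    · exact (hK.trans_adj_not_adj hs hirr (hs _ _ hkj) hne.symm (fun h => hik (hs _ _ h))
        (hd ▸ hz) hd.symm).symm hs
    · simp only [len_mul, len_gen] at hz
      rcases hK i j c d (by omega) hd with ⟨rfl, rfl⟩ | ⟨hij, e, rfl, rfl⟩ | ⟨hne₃, hij, e, rfl, rfl⟩
      · exact .inl ⟨rfl, rfl⟩
      · refine .inr (.inl ⟨hij, gen adj k * e, ?_, ?_⟩)
        · rw [comm_mul hne' hkj, ← comm_mul hne hik]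
        · rw [← comm_mul hne hik, comm_mul hne' hkj]
      · refine .inr (.inr ⟨hne₃, hij, gen adj k * e, ?_, ?_⟩)
        · rw [comm_mul hne' hkj]
        · rw [comm_mul hne hik]

theorem residual_of_rel (hs : ∀ i j, adj i j → adj j i) (hirr : ∀ i, ¬ adj i i)
    (htri : ∀ i j k, adj i j → adj j k → ¬ adj i k) {u v : FreeMonoid I}
    (h : ConGen.Rel (ArtinRel adj) u v) (hu : len (PresentedMonoid.mk (ArtinRel adj) u) ≤ N + 1)
    {i j : I} {a b : FreeMonoid I} (ha : u = FreeMonoid.of i * a) (hb : v = FreeMonoid.of j * b) :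
    Residual i j (PresentedMonoid.mk (ArtinRel adj) a) (PresentedMonoid.mk (ArtinRel adj) b) := by
  have inj : ∀ {i j : I} {a b : FreeMonoid I}, FreeMonoid.of i * a = FreeMonoid.of j * b →
      i = j ∧ a = b := fun h => List.cons.inj h
  have key : ∀ {u v : FreeMonoid I}, ConGen.Rel (ArtinRel adj) u v →
      PresentedMonoid.mk (ArtinRel adj) u = PresentedMonoid.mk (ArtinRel adj) v :=
    fun h => PresentedMonoid.mk_eq_mk_iff.2 h
  have lenof : ∀ (i : I) (a : FreeMonoid I),
      len (PresentedMonoid.mk (ArtinRel adj) (FreeMonoid.of i * a)) =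
        1 + len (PresentedMonoid.mk (ArtinRel adj) a) := fun i a => by
    rw [map_mul, len_mul]; rfl
  induction h generalizing i j a b with
  | of u v h =>
    rcases h with h | ⟨hne, h⟩
    · rw [mul_assoc] at ha hb
      obtain ⟨rfl, rfl⟩ := inj ha
      obtain ⟨rfl, rfl⟩ := inj hb
      exact .inr (.inl ⟨h, 1, rfl, rfl⟩)
    · obtain ⟨rfl, rfl⟩ := inj ha
      obtain ⟨rfl, rfl⟩ := inj hb
      exact .inr (.inr ⟨hne, h, 1, rfl, rfl⟩)
  | refl u =>
    obtain ⟨rfl, rfl⟩ := inj (ha.symm.trans hb)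
    exact .inl ⟨rfl, rfl⟩
  | symm h ih => exact (ih (key h ▸ hu) hb ha).symm hs
  | @trans u w v h₁ h₂ ih₁ ih₂ =>
    have hw := key h₁
    induction w using FreeMonoid.casesOn with
    | one =>
      subst ha
      have := congrArg len hw
      rw [lenof, map_one, len_one] at this
      omega
    | of_mul k c =>
      have hu' := hu
      rw [hw, lenof] at hu'
      exact hK.residual_trans hs hirr htri (by omega) (ih₁ hu ha rfl) (ih₂ (hw ▸ hu) rfl hb)
  | @mul u u' v v' h₁ h₂ ih₁ ih₂ =>
    have hw := key h₁
    rw [map_mul, len_mul] at hu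
    induction u using FreeMonoid.casesOn with
    | one =>
      induction u' using FreeMonoid.casesOn with
      | one => exact ih₂ (by omega) (by simpa using ha) (by simpa using hb)
      | of_mul k c =>
        have := congrArg len hw
        rw [lenof, map_one, len_one] at this
        omega
    | of_mul l d =>
      induction u' using FreeMonoid.casesOn with
      | one =>
        have := congrArg len hw
        rw [lenof, map_one, len_one] at this
        omega
      | of_mul k c =>
        rw [mul_assoc] at ha hb
        obtain ⟨rfl, rfl⟩ := inj ha
        obtain ⟨rfl, rfl⟩ := inj hb
        rw [map_mul, map_mul, ← key h₂]
        exact (ih₁ (by omega) rfl rfl).mul_right _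

end ResolvesBelow

section Lattice

variable (hs : ∀ i j, adj i j → adj j i) (hirr : ∀ i, ¬ adj i i)
  (htri : ∀ i j k, adj i j → adj j k → ¬ adj i k)
include hs hirr htri

theorem resolvesBelow (N : ℕ) : ResolvesBelow adj N := by
  induction N with
  | zero => exact fun _ _ _ _ h => absurd h (Nat.not_lt_zero _)
  | succ N ih =>
    intro i j x y hx h
    obtain ⟨u, rfl⟩ := PresentedMonoid.surjective_mk x
    obtain ⟨v, rfl⟩ := PresentedMonoid.surjective_mk y
    refine ih.residual_of_rel hs hirr htri (u := FreeMonoid.of i * u) (v := FreeMonoid.of j * v)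
      (PresentedMonoid.mk_eq_mk_iff.1 h) ?_ rfl rfl
    have : len (gen adj i * PresentedMonoid.mk _ u) ≤ N + 1 := by simp; omega
    exact this

theorem residual_of_mul_eq_mul {i j : I} {x y : ArtinMonoid adj}
    (h : gen adj i * x = gen adj j * y) : Residual i j x y :=
  resolvesBelow hs hirr htri (len x + 1) i j x y (Nat.lt_succ_self _) h

theorem mul_left_cancel' {a x y : ArtinMonoid adj} (h : a * x = a * y) : x = y := by
  induction hN : len a generalizing a with
  | zero =>
    rw [len_eq_zero.1 hN] at h
    simpa using h
  | succ N ih =>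
    rcases eq_one_or_exists_gen_mul a with rfl | ⟨i, a, rfl⟩
    · simp at hN
    · rw [mul_assoc, mul_assoc] at h
      refine ih ((resolvesBelow hs hirr htri _).cancel (hirr i) (Nat.lt_succ_self _) h) ?_
      simp at hN
      omega

/-- Two generators with a common multiple have a least common one. -/
theorem exists_lcm_gen {i j : I} {z : ArtinMonoid adj} (hi : gen adj i ∣ z) (hj : gen adj j ∣ z) :
    ∃ m, gen adj i ∣ m ∧ gen adj j ∣ m ∧ ∀ w, gen adj i ∣ w → gen adj j ∣ w → m ∣ w := by
  obtain ⟨x, rfl⟩ := hi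
  obtain ⟨y, hy⟩ := hj
  by_cases hij : i = j
  · subst hij
    exact ⟨gen adj i, dvd_rfl, dvd_rfl, fun _ h _ => h⟩
  by_cases hadj : adj i j
  · refine ⟨gen adj i * (gen adj j * gen adj i), dvd_mul_right _ _,
      ⟨gen adj i * gen adj j, by simpa using braid_mul hadj 1⟩, ?_⟩
    rintro _ ⟨u, rfl⟩ ⟨v, hv⟩
    obtain ⟨c, rfl, -⟩ := (resolvesBelow hs hirr htri (len u + 1)).of_adj hirr hadj
      (Nat.lt_succ_self _) hv
    exact ⟨c, by simp only [mul_assoc]⟩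
  · refine ⟨gen adj i * gen adj j, dvd_mul_right _ _,
      ⟨gen adj i, by simpa using comm_mul hij hadj 1⟩, ?_⟩
    rintro _ ⟨u, rfl⟩ ⟨v, hv⟩
    obtain ⟨c, rfl, -⟩ := (resolvesBelow hs hirr htri (len u + 1)).of_not_adj hij hadj
      (Nat.lt_succ_self _) hv
    exact ⟨c, by simp only [mul_assoc]⟩

theorem dvd_of_mul_dvd_mul_left' {a x y : ArtinMonoid adj} (h : a * x ∣ a * y) : x ∣ y := by
  obtain ⟨c, hc⟩ := h
  rw [mul_assoc] at hc
  exact ⟨c, mul_left_cancel' hs hirr htri hc⟩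

/-- Two elements with a common multiple have a least common one. -/
theorem exists_lcm {a b z : ArtinMonoid adj} (ha : a ∣ z) (hb : b ∣ z) :
    ∃ m, a ∣ m ∧ b ∣ m ∧ ∀ w, a ∣ w → b ∣ w → m ∣ w := by
  induction hN : len z using Nat.strong_induction_on generalizing a b z with
  | _ N ih =>
  rcases eq_one_or_exists_gen_mul a with rfl | ⟨i, a, rfl⟩
  · exact ⟨b, one_dvd _, dvd_rfl, fun _ _ h => h⟩
  rcases eq_one_or_exists_gen_mul b with rfl | ⟨j, b, rfl⟩
  · exact ⟨_, dvd_rfl, one_dvd _, fun _ h _ => h⟩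
  have cancel := @dvd_of_mul_dvd_mul_left' _ _ hs hirr htri
  obtain ⟨m, him, hjm, hm⟩ := exists_lcm_gen hs hirr htri
    ((dvd_mul_right _ _).trans ha) ((dvd_mul_right _ _).trans hb)
  have hmz := hm z ((dvd_mul_right _ _).trans ha) ((dvd_mul_right _ _).trans hb)
  obtain ⟨f, rfl⟩ := him
  obtain ⟨x, rfl⟩ := (dvd_mul_right _ _).trans ha
  obtain ⟨p, hap, hfp, hp⟩ := ih (len x) (by simp at hN; omega) (cancel ha) (cancel hmz) rfl
  obtain ⟨q, hq⟩ := hjm.trans (mul_dvd_mul_left (gen adj i) hfp)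
  obtain ⟨y, hy⟩ := (dvd_mul_right _ _).trans hb
  have hqy : gen adj j * q ∣ gen adj j * y :=
    hq ▸ hy ▸ mul_dvd_mul_left _ (hp x (cancel ha) (cancel hmz))
  obtain ⟨r, hbr, hqr, hr⟩ := ih (len y) (by rw [hy] at hN; simp at hN; omega)
    (cancel (hy ▸ hb)) (cancel hqy) rfl
  refine ⟨gen adj j * r, ?_, mul_dvd_mul_left _ hbr, ?_⟩
  · exact (mul_dvd_mul_left _ hap).trans (hq ▸ mul_dvd_mul_left _ hqr)
  · intro w haw hbw
    have hmw := hm w ((dvd_mul_right _ _).trans haw) ((dvd_mul_right _ _).trans hbw)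
    obtain ⟨w', rfl⟩ := (dvd_mul_right _ _).trans hbw
    refine mul_dvd_mul_left _ (hr _ (cancel hbw) (cancel (a := gen adj j) ?_))
    rw [← hq]
    obtain ⟨w'', hw''⟩ := (dvd_mul_right _ _).trans haw
    rw [hw''] at haw hmw ⊢
    exact mul_dvd_mul_left _ (hp _ (cancel haw) (cancel hmw))

theorem exists_gcd (a b : ArtinMonoid adj) :
    ∃ d, d ∣ a ∧ d ∣ b ∧ ∀ c, c ∣ a → c ∣ b → c ∣ d := by
  have len_le : ∀ {x y : ArtinMonoid adj}, x ∣ y → len x ≤ len y := by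
    rintro x _ ⟨c, rfl⟩; simp
  let S : Set ℕ := {k | ∃ d, d ∣ a ∧ d ∣ b ∧ len d = k}
  have hS : BddAbove S := ⟨len a, by rintro _ ⟨d, hd, -, rfl⟩; exact len_le hd⟩
  obtain ⟨d, hda, hdb, hd⟩ := Nat.sSup_mem (s := S) ⟨0, 1, one_dvd _, one_dvd _, len_one⟩ hS
  refine ⟨d, hda, hdb, fun c hca hcb => ?_⟩
  obtain ⟨m, ⟨e, rfl⟩, hcm, hm⟩ := exists_lcm hs hirr htri hda hca
  have hle : len (d * e) ≤ len d :=
    hd ▸ le_csSup hS ⟨d * e, hm a hda hca, hm b hdb hcb, rfl⟩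
  have he : e = 1 := len_eq_zero.1 (by simp at hle; exact hle)
  simpa [he] using hcm

theorem dvd_mul_of_isGCD {a b d p c : ArtinMonoid adj}
    (hd : ∀ c, c ∣ a → c ∣ b → c ∣ d) (ha : c ∣ p * a) (hb : c ∣ p * b) : c ∣ p * d := by
  obtain ⟨e, hea, heb, he⟩ := exists_gcd hs hirr htri (p * a) (p * b)
  obtain ⟨f, rfl⟩ := he p (dvd_mul_right _ _) (dvd_mul_right _ _)
  have cancel := @dvd_of_mul_dvd_mul_left' _ _ hs hirr htri
  exact (he c ha hb).trans (mul_dvd_mul_left p (hd f (cancel hea) (cancel heb)))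

end Lattice

end ArtinMonoid

/-- A sequence whose terms satisfy the far commutation relations, and whose first `N` terms
satisfy the braid relations. -/
structure IsBraidSeq {M : Type*} [Monoid M] (s : ℕ → M) (N : ℕ) : Prop where
  braid : ∀ i, i + 1 < N → s i * (s (i + 1) * s i) = s (i + 1) * (s i * s (i + 1))
  comm : ∀ i j, i + 1 < j → Commute (s i) (s j)

namespace IsBraidSeq

variable {M : Type*} [Monoid M]

/-- The product `s k * s (k - 1) * ⋯ * s 0`. -/
def stair (s : ℕ → M) : ℕ → M
  | 0 => s 0
  | k + 1 => s (k + 1) * stair s k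

/-- The half-twist on the first `m` terms of the sequence. -/
def halfTwist (s : ℕ → M) : ℕ → M
  | 0 => 1
  | m + 1 => halfTwist s m * stair s m

theorem map_stair {M' : Type*} [Monoid M'] (f : M →* M') (s : ℕ → M) (k : ℕ) :
    f (stair s k) = stair (fun i => f (s i)) k := by
  induction k with
  | zero => rfl
  | succ k ih => simp only [stair, map_mul, ih]

theorem map_halfTwist {M' : Type*} [Monoid M'] (f : M →* M') (s : ℕ → M) (m : ℕ) :
    f (halfTwist s m) = halfTwist (fun i => f (s i)) m := by
  induction m with
  | zero => exact map_one f
  | succ m ih => simp only [halfTwist, map_mul, ih, map_stair]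

theorem stair_eq_prod (s : ℕ → M) (k : ℕ) :
    stair s k = ((List.range (k + 1)).reverse.map s).prod := by
  induction k with
  | zero => simp [stair]
  | succ k ih => rw [stair, ih, List.range_succ (n := k + 1)]; simp

theorem halfTwist_eq_prod (s : ℕ → M) (m : ℕ) :
    halfTwist s m = ((List.range m).map (stair s)).prod := by
  induction m with
  | zero => simp [halfTwist]
  | succ m ih => rw [halfTwist, ih, List.range_succ]; simp

variable {s : ℕ → M} {N : ℕ} (h : IsBraidSeq s N)
include h

theorem commute_stair {k j : ℕ} (hkj : k + 1 < j) : Commute (stair s k) (s j) := by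
  induction k with
  | zero => exact h.comm _ _ hkj
  | succ k ih => exact (h.comm _ _ hkj).mul_left (ih (by omega))

theorem commute_halfTwist {m j : ℕ} (hmj : m < j) : Commute (halfTwist s m) (s j) := by
  induction m with
  | zero => exact Commute.one_left _
  | succ m ih => exact (ih (by omega)).mul_left (h.commute_stair hmj)

theorem stair_mul_succ {k i : ℕ} (hk : k < N) (hi : i < k) :
    stair s k * s (i + 1) = s i * stair s k := by
  induction k with
  | zero => omega
  | succ k ih =>
    rcases Nat.lt_succ_iff_lt_or_eq.1 hi with hik | rfl
    · rw [stair, mul_assoc, ih (by omega) hik, ← mul_assoc, ← (h.comm i (k + 1) (by omega)).eq,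
        mul_assoc]
    · rcases i with _ | i
      · simpa [stair, mul_assoc] using (h.braid 0 hk).symm
      · have hc := (h.commute_stair (k := i) (j := i + 1 + 1) (by omega)).eq
        simp only [stair]
        rw [mul_assoc, mul_assoc, hc, ← mul_assoc (s (i + 1)), ← mul_assoc (s (i + 1 + 1)),
          ← h.braid (i + 1) hk]
        simp only [mul_assoc]

theorem stair_mul_stair_succ_mul {k : ℕ} (hk : k + 1 < N) :
    stair s k * stair s (k + 1) * s 0 = s (k + 1) * (stair s k * stair s (k + 1)) := by
  induction k with
  | zero =>
    have := h.braid 0 hk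
    simp only [zero_add] at this
    simp only [stair, ← mul_assoc, zero_add] at this ⊢
    rw [this]
  | succ k ih =>
    have hc := (h.commute_stair (k := k) (j := k + 1 + 1) (by omega)).eq
    have hb := h.braid (k + 1) hk
    have ht : stair s (k + 1) * stair s (k + 1 + 1) =
        s (k + 1) * (s (k + 1 + 1) * (stair s k * stair s (k + 1))) := by
      rw [stair, stair, mul_assoc, ← mul_assoc (stair s k), hc, mul_assoc]
      rfl
    rw [ht, mul_assoc, mul_assoc, ih (by omega), ← mul_assoc (s (k + 1 + 1)),
      ← mul_assoc (s (k + 1)), hb]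
    simp only [mul_assoc]

theorem halfTwist_mul {m i j : ℕ} (hm : m ≤ N) (hij : i + j + 1 = m) :
    halfTwist s m * s i = s j * halfTwist s m := by
  induction m generalizing i j with
  | zero => omega
  | succ m ih =>
    rcases i with _ | i
    · obtain rfl : j = m := by omega
      rcases j with _ | j
      · simp [halfTwist, stair]
      · have hc := (h.commute_halfTwist (m := j) (j := j + 1) (by omega)).eq
        have := h.stair_mul_stair_succ_mul (k := j) (by omega)
        rw [halfTwist, halfTwist, mul_assoc _ (stair s j), mul_assoc, this, ← mul_assoc, hc,
          mul_assoc]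
    · rw [halfTwist, mul_assoc, h.stair_mul_succ (by omega) (by omega), ← mul_assoc,
        ih (i := i) (j := j) (by omega) (by omega), mul_assoc]

theorem exists_stair_mul_stair {k m : ℕ} (hk : k < m) (hm : m < N) :
    ∃ x, stair s k * stair s m = stair s m * x := by
  induction k with
  | zero => exact ⟨s 1, (h.stair_mul_succ hm hk).symm⟩
  | succ k ih =>
    obtain ⟨x, hx⟩ := ih (by omega)
    exact ⟨s (k + 1 + 1) * x, by
      rw [stair, mul_assoc, hx, ← mul_assoc, ← mul_assoc, h.stair_mul_succ hm hk]⟩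

theorem exists_halfTwist_mul_stair {k m : ℕ} (hk : k ≤ m) (hm : m < N) :
    ∃ x, halfTwist s k * stair s m = stair s m * x := by
  induction k with
  | zero => exact ⟨1, by simp [halfTwist]⟩
  | succ k ih =>
    obtain ⟨x, hx⟩ := ih (by omega)
    obtain ⟨y, hy⟩ := h.exists_stair_mul_stair (k := k) (by omega) hm
    exact ⟨x * y, by rw [halfTwist, mul_assoc, hy, ← mul_assoc, hx, mul_assoc]⟩

theorem dvd_halfTwist {m i : ℕ} (hm : m ≤ N) (hi : i < m) : s i ∣ halfTwist s m := by
  induction m with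
  | zero => omega
  | succ m ih =>
    rcases Nat.lt_succ_iff_lt_or_eq.1 hi with him | rfl
    · exact (ih (by omega) him).mul_right _
    · obtain ⟨x, hx⟩ := h.exists_halfTwist_mul_stair le_rfl (m := i) (by omega)
      rw [halfTwist, hx]
      refine Dvd.dvd.mul_right ?_ _
      rcases i with _ | i
      · exact dvd_rfl
      · exact dvd_mul_right _ _

end IsBraidSeq

/-- Adjacency of the Artin generators of the braid group. -/
def braidAdj (n : ℕ) (i j : Fin (n - 1)) : Prop := (i : ℕ) + 1 = j ∨ (j : ℕ) + 1 = i

/-- The braid monoid, given by the positive Artin presentation. -/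
abbrev BraidMonoid (n : ℕ) := ArtinMonoid (braidAdj n)

namespace BraidMonoid

open ArtinMonoid IsBraidSeq

theorem braidAdj_symm (n : ℕ) : ∀ i j, braidAdj n i j → braidAdj n j i := fun _ _ => Or.symm

theorem braidAdj_irrefl (n : ℕ) : ∀ i, ¬ braidAdj n i i := by
  intro i h
  unfold braidAdj at h
  omega

theorem braidAdj_triangle_free (n : ℕ) :
    ∀ i j k, braidAdj n i j → braidAdj n j k → ¬ braidAdj n i k := by
  intro i j k h₁ h₂ h₃
  unfold braidAdj at h₁ h₂ h₃
  omega

/-- The generators as a sequence, continued by `1`. -/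
def genSeq (n : ℕ) (i : ℕ) : BraidMonoid n :=
  if h : i < n - 1 then gen (braidAdj n) ⟨i, h⟩ else 1

theorem genSeq_val {n : ℕ} (i : Fin (n - 1)) : genSeq n i = gen (braidAdj n) i := by
  simp [genSeq]

theorem isBraidSeq_genSeq (n : ℕ) : IsBraidSeq (genSeq n) (n - 1) where
  braid i hi := by
    have h : braidAdj n ⟨i, by omega⟩ ⟨i + 1, hi⟩ := .inl rfl
    have hi' : i < n - 1 := by omega
    simpa [genSeq, hi, hi'] using braid_mul h 1
  comm i j hij := by
    unfold genSeq
    split_ifs with hi hj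
    · have hne : (⟨i, hi⟩ : Fin (n - 1)) ≠ ⟨j, hj⟩ := by simp; omega
      have h : ¬ braidAdj n ⟨i, hi⟩ ⟨j, hj⟩ := by simp [braidAdj]; omega
      simpa [Commute, SemiconjBy] using comm_mul hne h 1
    · exact Commute.one_right _
    · exact Commute.one_left _
    · exact Commute.one_left _

/-- The half-twist of the braid monoid. -/
def delta (n : ℕ) : BraidMonoid n := halfTwist (genSeq n) (n - 1)

theorem gen_dvd_delta {n : ℕ} (i : Fin (n - 1)) : gen (braidAdj n) i ∣ delta n := by
  rw [← genSeq_val]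
  exact (isBraidSeq_genSeq n).dvd_halfTwist le_rfl i.2

theorem delta_mul_gen {n : ℕ} (i : Fin (n - 1)) :
    delta n * gen (braidAdj n) i = gen (braidAdj n) i.rev * delta n := by
  rw [← genSeq_val, ← genSeq_val]
  exact (isBraidSeq_genSeq n).halfTwist_mul le_rfl (by rw [Fin.val_rev]; omega)

theorem gen_mul_delta {n : ℕ} (i : Fin (n - 1)) :
    gen (braidAdj n) i * delta n = delta n * gen (braidAdj n) i.rev := by
  rw [delta_mul_gen, Fin.rev_rev]

theorem exists_mul_gen_eq_delta {n : ℕ} (i : Fin (n - 1)) :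
    ∃ x, x * gen (braidAdj n) i = delta n := by
  obtain ⟨c, hc⟩ := gen_dvd_delta i.rev
  refine ⟨c, mul_left_cancel' (braidAdj_symm n) (braidAdj_irrefl n) (braidAdj_triangle_free n)
    (a := gen (braidAdj n) i.rev) ?_⟩
  rw [← mul_assoc, ← hc, delta_mul_gen]

theorem induction_gen {n : ℕ} {p : BraidMonoid n → Prop} (h₁ : p 1)
    (hg : ∀ i x, p x → p (gen (braidAdj n) i * x)) (x : BraidMonoid n) : p x := by
  induction hN : len x generalizing x with
  | zero => rwa [len_eq_zero.1 hN]
  | succ N ih =>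
    rcases eq_one_or_exists_gen_mul x with rfl | ⟨i, y, rfl⟩
    · exact h₁
    · exact hg i y (ih y (by simp at hN; omega))

theorem exists_delta_mul_eq {n : ℕ} (x : BraidMonoid n) : ∃ y, delta n * x = y * delta n := by
  induction x using induction_gen with
  | h₁ => exact ⟨1, by simp⟩
  | hg i x ih =>
    obtain ⟨y, hy⟩ := ih
    exact ⟨gen _ i.rev * y, by rw [← mul_assoc, delta_mul_gen, mul_assoc, hy, mul_assoc]⟩

theorem exists_mul_delta_eq {n : ℕ} (x : BraidMonoid n) : ∃ y, x * delta n = delta n * y := by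
  induction x using induction_gen with
  | h₁ => exact ⟨1, by simp⟩
  | hg i x ih =>
    obtain ⟨y, hy⟩ := ih
    exact ⟨gen _ i.rev * y, by rw [mul_assoc, hy, ← mul_assoc, gen_mul_delta, mul_assoc]⟩

theorem commute_delta_sq {n : ℕ} (x : BraidMonoid n) : Commute (delta n * delta n) x := by
  induction x using induction_gen with
  | h₁ => exact Commute.one_right _
  | hg i x ih =>
    refine Commute.mul_right ?_ ih
    change _ * _ = _ * _
    rw [mul_assoc, delta_mul_gen, ← mul_assoc, delta_mul_gen, Fin.rev_rev, mul_assoc]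

theorem isUnit_of_isUnit_delta_sq {n : ℕ} {M : Type*} [Monoid M] (f : BraidMonoid n →* M)
    (h : IsUnit (f (delta n * delta n))) (i : Fin (n - 1)) : IsUnit (f (gen (braidAdj n) i)) := by
  obtain ⟨c, hc⟩ := gen_dvd_delta i
  obtain ⟨c', hc'⟩ := exists_mul_gen_eq_delta i
  obtain ⟨u, hu⟩ := h
  refine isUnit_iff_exists_and_exists.2
    ⟨⟨f (c * delta n) * ↑u⁻¹, ?_⟩, ⟨↑u⁻¹ * f (delta n * c'), ?_⟩⟩
  · rw [← mul_assoc, ← map_mul, ← mul_assoc, ← hc, ← hu, Units.mul_inv]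
  · rw [mul_assoc, ← map_mul, mul_assoc, hc', ← hu, Units.inv_mul]

/-- The braid monoid embeds in the braid group. -/
def toGroup (n : ℕ) : BraidMonoid n →* BraidGroup n :=
  PresentedMonoid.lift (braidGen n) <| by
    have hb : ∀ i j : Fin (n - 1), (i : ℕ) + 1 = j →
        braidGen n i * braidGen n j * braidGen n i =
          braidGen n j * braidGen n i * braidGen n j := fun i j h => by
      have := (QuotientGroup.eq_one_iff (N := Subgroup.normalClosure (braidRels n)) _).2
        (Subgroup.subset_normalClosure (.inl ⟨i, j, h, rfl⟩))
      exact mul_inv_eq_one.1 this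
    have hc : ∀ i j : Fin (n - 1), (i : ℕ) + 1 < j →
        braidGen n i * braidGen n j = braidGen n j * braidGen n i := fun i j h => by
      have := (QuotientGroup.eq_one_iff (N := Subgroup.normalClosure (braidRels n)) _).2
        (Subgroup.subset_normalClosure (.inr ⟨i, j, h, rfl⟩))
      exact mul_inv_eq_one.1 this
    rintro _ _ (⟨h | h⟩ | ⟨hne, h⟩)
    · simpa using hb _ _ h
    · simpa using (hb _ _ h).symm
    · rename_i i j
      simp only [map_mul, FreeMonoid.lift_eval_of]
      unfold braidAdj at h
      have : (i : ℕ) ≠ j := fun h' => hne (Fin.ext h')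
      rcases lt_or_gt_of_ne this with h' | h'
      · exact hc _ _ (by omega)
      · exact (hc _ _ (by omega)).symm

theorem toGroup_gen {n : ℕ} (i : Fin (n - 1)) :
    toGroup n (gen (braidAdj n) i) = braidGen n i := rfl

open OreLocalization in
theorem toGroup_injective (n : ℕ) : Function.Injective (toGroup n) := by
  let S : Submonoid (BraidMonoid n) := Submonoid.powers (delta n * delta n)
  have hS : ∀ (s : S) (x : BraidMonoid n), (s : BraidMonoid n) * x = x * s := by
    rintro ⟨_, k, rfl⟩ x
    exact ((commute_delta_sq x).pow_left k).eq
  let _ : OreSet S :=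
    { ore_right_cancel := fun r₁ r₂ s h => ⟨s, by rw [hS, hS, h]⟩
      oreNum := fun r _ => r
      oreDenom := fun _ s => s
      ore_eq := fun r s => hS s r }
  let f : BraidMonoid n →* OreLocalization S (BraidMonoid n) := numeratorHom
  have hf : Function.Injective f := by
    intro x y hxy
    obtain ⟨u, v, h₁, h₂⟩ := oreDiv_eq_iff.1 (hxy : x /ₒ (1 : S) = y /ₒ (1 : S))
    have h₃ : (u : BraidMonoid n) = v := by simpa using h₂
    refine (mul_left_cancel' (braidAdj_symm n) (braidAdj_irrefl n) (braidAdj_triangle_free n)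
      (a := v) ?_).symm
    rw [← h₃]
    exact h₁.trans (by rw [← h₃]; rfl)
  have hu := isUnit_of_isUnit_delta_sq f (numerator_isUnit ⟨_, Submonoid.mem_powers _⟩)
  let u : Fin (n - 1) → (OreLocalization S (BraidMonoid n))ˣ := fun i => (hu i).unit
  have hrel : ∀ r ∈ braidRels n, FreeGroup.lift u r = 1 := by
    rintro _ (⟨i, j, h, rfl⟩ | ⟨i, j, h, rfl⟩)
    · simp only [map_mul, map_inv, FreeGroup.lift_apply_of, mul_inv_eq_one]
      ext
      have := congrArg f (braid_mul (adj := braidAdj n) (.inl h) 1)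
      simpa [u, mul_assoc] using this
    · simp only [map_mul, map_inv, FreeGroup.lift_apply_of, mul_inv_eq_one]
      ext
      have hadj : ¬ braidAdj n i j := by unfold braidAdj; omega
      have hne : i ≠ j := by rintro rfl; omega
      have := congrArg f (comm_mul hne hadj 1)
      simpa [u] using this
  have hcomp : ((Units.coeHom _).comp (PresentedGroup.toGroup hrel)).comp (toGroup n) = f :=
    PresentedMonoid.ext _ fun i => by
      exact congrArg Units.val (PresentedGroup.toGroup.of hrel (x := i))
  intro x y hxy
  apply hf
  rw [← hcomp]
  simp only [MonoidHom.comp_apply, hxy]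

theorem mem_posBraid_iff {n : ℕ} {g : BraidGroup n} : g ∈ PosBraid n ↔ ∃ x, toGroup n x = g := by
  have : PosBraid n = MonoidHom.mrange (toGroup n) := by
    rw [MonoidHom.mrange_eq_map, ← PresentedMonoid.closure_range_of, MonoidHom.map_mclosure,
      ← Set.range_comp]
    rfl
  rw [this, MonoidHom.mem_mrange]

theorem toGroup_mem {n : ℕ} (x : BraidMonoid n) : toGroup n x ∈ PosBraid n :=
  mem_posBraid_iff.2 ⟨x, rfl⟩

theorem toGroup_delta (n : ℕ) : toGroup n (delta n) = braidDelta n := by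
  have hg : ∀ i : Fin (n - 1), toGroup n (genSeq n i) = braidGen n i := fun i => by
    rw [genSeq_val, toGroup_gen]
  rw [delta, map_halfTwist, halfTwist_eq_prod, braidDelta, ← List.map_coe_finRange_eq_range,
    List.map_map]
  refine congrArg List.prod (List.map_congr_left fun k _ => ?_)
  rw [Function.comp_apply, stair_eq_prod]
  have hr : List.range ((k : ℕ) + 1) =
      ((List.finRange (n - 1)).filter (fun i => decide (i ≤ k))).map Fin.val := by
    have : (fun i : Fin (n - 1) => decide (i ≤ k)) = (fun i : ℕ => decide (i ≤ k)) ∘ Fin.val := rfl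
    rw [this, ← List.filter_map, List.map_coe_finRange_eq_range]
    refine List.Perm.eq_of_pairwise (fun a b _ _ h₁ h₂ => absurd (h₁.trans h₂) (lt_irrefl a))
      List.pairwise_lt_range (List.pairwise_lt_range.filter _) ?_
    refine (List.perm_ext_iff_of_nodup List.nodup_range (List.nodup_range.filter _)).2 fun a => ?_
    simp only [List.mem_range, List.mem_filter, decide_eq_true_eq]
    omega
  rw [hr, ← List.map_reverse, List.map_map]
  exact congrArg List.prod (List.map_congr_left fun i _ => hg i)

theorem prefixLE_toGroup_iff {n : ℕ} {x y : BraidMonoid n} :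
    PrefixLE n (toGroup n x) (toGroup n y) ↔ x ∣ y := by
  constructor
  · rintro ⟨_, hc, h⟩
    obtain ⟨c, rfl⟩ := mem_posBraid_iff.1 hc
    exact ⟨c, toGroup_injective n (by rw [map_mul, h])⟩
  · rintro ⟨c, rfl⟩
    exact ⟨_, toGroup_mem c, (map_mul _ _ _).symm⟩

end BraidMonoid

section Conjugation

open BraidMonoid ArtinMonoid

variable {n : ℕ}

theorem conj_delta_zpow_mem_posBraid {x : BraidGroup n} (hx : x ∈ PosBraid n) (j : ℤ) :
    braidDelta n ^ j * x * (braidDelta n ^ j)⁻¹ ∈ PosBraid n := by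
  induction j with
  | zero => simpa using hx
  | succ j ih =>
    obtain ⟨y, hy⟩ := mem_posBraid_iff.1 ih
    obtain ⟨z, hz⟩ := exists_delta_mul_eq y
    refine mem_posBraid_iff.2 ⟨z, ?_⟩
    have := congrArg (toGroup n) hz
    rw [map_mul, map_mul, toGroup_delta, hy] at this
    rw [eq_mul_inv_of_mul_eq this.symm, zpow_add_one, zpow_natCast,
      (Commute.self_pow (braidDelta n) j).symm.eq]
    group
  | pred j ih =>
    obtain ⟨y, hy⟩ := mem_posBraid_iff.1 ih
    obtain ⟨z, hz⟩ := exists_mul_delta_eq y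
    refine mem_posBraid_iff.2 ⟨z, ?_⟩
    have := congrArg (toGroup n) hz
    rw [map_mul, map_mul, toGroup_delta, hy] at this
    rw [eq_inv_mul_of_mul_eq this.symm]
    group

theorem commute_delta_sq_pow (m : ℕ) (g : BraidGroup n) :
    Commute ((braidDelta n * braidDelta n) ^ m) g := by
  have hg : g ∈ Subgroup.centralizer {braidDelta n * braidDelta n} := by
    refine PresentedGroup.generated_by _ _ (fun i => ?_) g
    rw [Subgroup.mem_centralizer_singleton_iff, ← toGroup_delta]
    have := congrArg (toGroup n) (commute_delta_sq (gen (braidAdj n) i)).eq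
    simp only [map_mul] at this ⊢
    exact this.symm
  exact (Commute.pow_right (Subgroup.mem_centralizer_singleton_iff.1 hg) m).symm

theorem exists_delta_sq_pow_mul_mem (g : BraidGroup n) :
    ∃ m : ℕ, (braidDelta n * braidDelta n) ^ m * g ∈ PosBraid n := by
  suffices h : ∃ m : ℕ, (braidDelta n * braidDelta n) ^ m * g ∈ PosBraid n ∧
      (braidDelta n * braidDelta n) ^ m * g⁻¹ ∈ PosBraid n from h.imp fun _ h => h.1
  have hmul : ∀ {m m' : ℕ} {x y : BraidGroup n},
      (braidDelta n * braidDelta n) ^ m * x ∈ PosBraid n →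
      (braidDelta n * braidDelta n) ^ m' * y ∈ PosBraid n →
      (braidDelta n * braidDelta n) ^ (m + m') * (x * y) ∈ PosBraid n := by
    intro m m' x y hx hy
    convert mul_mem hx hy using 1
    rw [pow_add, mul_assoc, ← mul_assoc _ x, (commute_delta_sq_pow m' x).eq]
    simp only [mul_assoc]
  have hg : g ∈ Subgroup.closure (Set.range (PresentedGroup.of (rels := braidRels n))) := by
    rw [PresentedGroup.closure_range_of]
    trivial
  induction hg using Subgroup.closure_induction with
  | mem x hx =>
    obtain ⟨i, rfl⟩ := hx
    obtain ⟨c, hc⟩ := gen_dvd_delta i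
    have hD : braidDelta n = PresentedGroup.of i * toGroup n c := by
      rw [← toGroup_delta, hc, map_mul]
      rfl
    have hpos := toGroup_mem (delta n)
    rw [toGroup_delta] at hpos
    refine ⟨1, ?_, ?_⟩
    · rw [pow_one]
      exact mul_mem (mul_mem hpos hpos) (toGroup_mem (gen _ i))
    · rw [(commute_delta_sq_pow 1 _).eq, pow_one]
      nth_rewrite 1 [hD]
      rw [mul_assoc, inv_mul_cancel_left]
      exact mul_mem (toGroup_mem c) hpos
  | one => exact ⟨0, by simp⟩
  | mul x y _ _ hx hy =>
    obtain ⟨m, hx, hx'⟩ := hx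
    obtain ⟨m', hy, hy'⟩ := hy
    refine ⟨m + m', hmul hx hy, ?_⟩
    rw [mul_inv_rev, add_comm]
    exact hmul hy' hx'
  | inv x _ hx =>
    obtain ⟨m, hx, hx'⟩ := hx
    exact ⟨m, hx', by rwa [inv_inv]⟩

/-- If conjugating by a positive braid keeps `inf` at least `j`, so does conjugating by its
greatest simple prefix. -/
theorem infGE_conj_of_isGCD {j : ℤ} {a : BraidGroup n} {w s : BraidMonoid n} (ha : InfGE n j a)
    (hw : InfGE n j ((toGroup n w)⁻¹ * a * toGroup n w)) (hsw : s ∣ w) (hsd : s ∣ delta n)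
    (hs : ∀ c, c ∣ w → c ∣ delta n → c ∣ s) :
    InfGE n j ((toGroup n s)⁻¹ * a * toGroup n s) := by
  obtain ⟨_, hp, rfl⟩ := ha
  obtain ⟨p, rfl⟩ := mem_posBraid_iff.1 hp
  obtain ⟨q, hq, hwq⟩ := hw
  have conj : ∀ x : BraidMonoid n, ∃ y, toGroup n y =
      (braidDelta n ^ j)⁻¹ * toGroup n x * braidDelta n ^ j := fun x => by
    have := conj_delta_zpow_mem_posBraid (toGroup_mem x) (-j)
    rw [zpow_neg, inv_inv] at this
    exact mem_posBraid_iff.1 this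
  obtain ⟨t, ht⟩ := conj s
  obtain ⟨u, rfl⟩ := hsw
  obtain ⟨v, hv⟩ := hsd
  obtain ⟨u', hu'⟩ := conj u
  obtain ⟨v', hv'⟩ := conj v
  have h₁ : t ∣ p * (s * u) := by
    rw [← prefixLE_toGroup_iff]
    refine ⟨toGroup n u' * q, mul_mem (toGroup_mem _) hq, ?_⟩
    have hq' : q = (braidDelta n ^ j)⁻¹ * ((toGroup n (s * u))⁻¹ *
        (braidDelta n ^ j * toGroup n p) * toGroup n (s * u)) := by rw [hwq]; group
    rw [hq', ht, hu']
    simp only [map_mul]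
    group
  have h₂ : t ∣ p * delta n := by
    obtain ⟨p', hp'⟩ := exists_mul_delta_eq p
    rw [hp']
    refine Dvd.dvd.mul_right ⟨v', toGroup_injective n ?_⟩ _
    have hD := congrArg (toGroup n) hv
    rw [toGroup_delta, map_mul] at hD
    rw [map_mul, toGroup_delta, ht, hv']
    calc braidDelta n = (braidDelta n ^ j)⁻¹ * braidDelta n * braidDelta n ^ j := by group
      _ = (braidDelta n ^ j)⁻¹ * (toGroup n s * toGroup n v) * braidDelta n ^ j := by rw [← hD]
      _ = _ := by group
  obtain ⟨r, hr⟩ := dvd_mul_of_isGCD (braidAdj_symm n) (braidAdj_irrefl n)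
    (braidAdj_triangle_free n) hs h₁ h₂
  refine ⟨toGroup n r, toGroup_mem r, ?_⟩
  have hr' := congrArg (toGroup n) hr
  rw [map_mul, map_mul, ht] at hr'
  rw [mul_assoc, mul_assoc, hr']
  group

theorem exists_simple_chain {r : ℕ} {α : Fin r → BraidGroup n} (w : BraidMonoid n)
    (δ : Fin r → BraidGroup n) (hδ : CInf n r α δ)
    (hw : CInf n r α fun i => (toGroup n w)⁻¹ * δ i * toGroup n w) :
    ∃ (k : ℕ) (A : Fin (k + 1) → Fin r → BraidGroup n) (s : Fin k → BraidGroup n),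
      A 0 = δ ∧ A (Fin.last k) = (fun i => (toGroup n w)⁻¹ * δ i * toGroup n w) ∧
      (∀ j, CInf n r α (A j)) ∧
      (∀ j : Fin k, IsSimple n (s j) ∧
        ∀ i, (s j)⁻¹ * A j.castSucc i * s j = A j.succ i) := by
  induction hN : len w using Nat.strong_induction_on generalizing w δ with
  | _ N ih =>
  rcases eq_one_or_exists_gen_mul w with rfl | ⟨g, w', hgw⟩
  · exact ⟨0, fun _ => δ, Fin.elim0, rfl, by simp, fun _ => hδ, fun j => j.elim0⟩
  obtain ⟨s, hsw, hsd, hs⟩ := exists_gcd (braidAdj_symm n) (braidAdj_irrefl n)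
    (braidAdj_triangle_free n) w (delta n)
  have hgs := hs _ ⟨w', hgw⟩ (gen_dvd_delta g)
  have hinf := fun i j hj =>
    infGE_conj_of_isGCD (hδ.1 i j hj) (hw.1 i j hj) hsw hsd hs
  obtain ⟨u, rfl⟩ := hsw
  have hδ' : CInf n r α fun i => (toGroup n s)⁻¹ * δ i * toGroup n s := by
    refine ⟨hinf, ?_⟩
    obtain ⟨ω, hω⟩ := hδ.2
    exact ⟨ω * toGroup n s, fun i => by simp only [hω]; group⟩
  have hend : (fun i => (toGroup n u)⁻¹ * ((toGroup n s)⁻¹ * δ i * toGroup n s) * toGroup n u) =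
      fun i => (toGroup n (s * u))⁻¹ * δ i * toGroup n (s * u) := by
    funext i
    rw [map_mul]
    group
  have hlen : len u < N := by
    obtain ⟨c, rfl⟩ := hgs
    simp at hN
    omega
  obtain ⟨k, A, S, hA₀, hA, hAC, hS⟩ := ih _ hlen u _ hδ' (hend ▸ hw) rfl
  refine ⟨k + 1, Fin.cons δ A, Fin.cons (toGroup n s) S, rfl, ?_, ?_, ?_⟩
  · rw [← Fin.succ_last, Fin.cons_succ, hA, hend]
  · exact Fin.cases hδ hAC
  · refine Fin.cases ⟨⟨toGroup_mem s, ?_⟩, fun i => ?_⟩ fun j => ?_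
    · rw [← toGroup_delta]
      exact prefixLE_toGroup_iff.2 hsd
    · simp only [Fin.cons_zero, Fin.cons_succ, Fin.castSucc_zero, hA₀]
    · simpa only [Fin.cons_succ, ← Fin.succ_castSucc] using hS j

end Conjugation

/-- every `β ∈ C^inf(α)` is reachable from `α` by a chain inside
`C^inf(α)` in which successive tuples are simultaneously conjugated by simple elements. -/
theorem stmt1 (n r : ℕ) (hn : 2 ≤ n) (α β : Fin r → BraidGroup n)
    (hβ : CInf n r α β) :
    ∃ (k : ℕ) (A : Fin (k + 1) → Fin r → BraidGroup n) (s : Fin k → BraidGroup n),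
      A 0 = α ∧ A (Fin.last k) = β ∧
      (∀ j, CInf n r α (A j)) ∧
      (∀ j : Fin k, IsSimple n (s j) ∧
        ∀ i, (s j)⁻¹ * A j.castSucc i * s j = A j.succ i) := by
  obtain ⟨ω, hω⟩ := hβ.2
  obtain ⟨m, hm⟩ := exists_delta_sq_pow_mul_mem ω
  obtain ⟨w, hw⟩ := BraidMonoid.mem_posBraid_iff.1 hm
  have hα : CInf n r α α := ⟨fun _ _ h => h, 1, by simp⟩
  have hend : (fun i => (BraidMonoid.toGroup n w)⁻¹ * α i * BraidMonoid.toGroup n w) = β := by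
    funext i
    have hc := (commute_delta_sq_pow m (α i)).eq
    rw [hω, hw, mul_inv_rev]
    simp only [mul_assoc]
    rw [← mul_assoc (α i), ← hc, mul_assoc, inv_mul_cancel_left]
  have := exists_simple_chain w α hα (hend ▸ hβ)
  rwa [hend] at this
end

section
/- Let T be a set of simple elements of B_n^+ that is closed under greatest common divisors, i.e. whenever s_1, s_2 ∈ T and d ∈ B_n^+ is a greatest common left-divisor of s_1 and s_2, then d ∈ T. Then the set of ≼-minimal elements of T ∖ {1} has at most n − 1 elements. -/
/-! ### Inversion numbers of functions on `ℕ` -/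

/-- The inversions of `f` among the pairs of indices below `n`. -/
def inversions (n : ℕ) (f : ℕ → ℕ) : Finset (ℕ × ℕ) :=
  (Finset.range n ×ˢ Finset.range n).filter (fun p => p.1 < p.2 ∧ f p.2 < f p.1)

theorem mem_inversions {n : ℕ} {f : ℕ → ℕ} {p : ℕ × ℕ} :
    p ∈ inversions n f ↔ p.1 < n ∧ p.2 < n ∧ p.1 < p.2 ∧ f p.2 < f p.1 := by
  simp [inversions, and_assoc]

theorem swap_succ_lt_swap_succ {i a b : ℕ} (hab : a < b) (h : ¬ (a = i ∧ b = i + 1)) :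
    Equiv.swap i (i + 1) a < Equiv.swap i (i + 1) b := by
  simp only [Equiv.swap_apply_def]
  split_ifs <;> omega

theorem swap_succ_lt {i n a : ℕ} (hi : i + 1 < n) (ha : a < n) :
    Equiv.swap i (i + 1) a < n := by
  simp only [Equiv.swap_apply_def]
  split_ifs <;> omega

theorem card_inversions_comp_swap {n i : ℕ} (hi : i + 1 < n) {f : ℕ → ℕ}
    (hf : f i < f (i + 1)) :
    (inversions n (f ∘ Equiv.swap i (i + 1))).card = (inversions n f).card + 1 := by
  set s := Equiv.swap i (i + 1) with hs
  have hss (a : ℕ) : s (s a) = a := Equiv.swap_apply_self i (i + 1) a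
  have hsi : s i = i + 1 := Equiv.swap_apply_left i (i + 1)
  have hsi' : s (i + 1) = i := Equiv.swap_apply_right i (i + 1)
  have hset : inversions n (f ∘ s) =
      insert (i, i + 1) ((inversions n f).image (Prod.map s s)) := by
    ext ⟨a, b⟩
    simp only [Finset.mem_insert, Finset.mem_image, mem_inversions, Function.comp, Prod.mk.injEq,
      Prod.exists, Prod.map_apply]
    constructor
    · rintro ⟨ha, hb, hab, h⟩
      by_cases hi' : a = i ∧ b = i + 1
      · exact Or.inl hi'
      · exact Or.inr ⟨s a, s b, ⟨swap_succ_lt hi ha, swap_succ_lt hi hb,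
          swap_succ_lt_swap_succ hab hi', h⟩, hss a, hss b⟩
    · rintro (⟨rfl, rfl⟩ | ⟨c, d, ⟨hc, hd, hcd, h⟩, rfl, rfl⟩)
      · exact ⟨by omega, hi, by omega, by rwa [hsi, hsi']⟩
      · refine ⟨swap_succ_lt hi hc, swap_succ_lt hi hd, swap_succ_lt_swap_succ hcd ?_, ?_⟩
        · rintro ⟨rfl, rfl⟩
          omega
        · rwa [hss, hss]
  rw [hset, Finset.card_insert_of_notMem, Finset.card_image_of_injective]
  · exact s.injective.prodMap s.injective
  · simp only [Finset.mem_image, mem_inversions, Prod.mk.injEq, Prod.exists, Prod.map_apply]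
    rintro ⟨c, d, ⟨-, -, hcd, -⟩, hc, hd⟩
    have h1 : c = i + 1 := by rw [← hss c, hc, hsi]
    have h2 : d = i := by rw [← hss d, hd, hsi']
    omega

theorem card_inversions_comp_swap_of_gt {n i : ℕ} (hi : i + 1 < n) {f : ℕ → ℕ}
    (hf : f (i + 1) < f i) :
    (inversions n (f ∘ Equiv.swap i (i + 1))).card + 1 = (inversions n f).card := by
  have h := card_inversions_comp_swap hi (f := f ∘ Equiv.swap i (i + 1)) (by simpa using hf)
  rw [← h, Function.comp_assoc, ← Equiv.Perm.coe_mul, Equiv.swap_mul_self, Equiv.Perm.coe_one,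
    Function.comp_id]

theorem card_inversions_swap_comp_le (n i : ℕ) (f : Equiv.Perm ℕ) :
    (inversions n (Equiv.swap i (i + 1) ∘ f)).card ≤ (inversions n f).card + 1 := by
  have hsub : inversions n (Equiv.swap i (i + 1) ∘ f) ⊆
      insert (f.symm i, f.symm (i + 1)) (inversions n f) := by
    rintro ⟨a, b⟩ h
    simp only [mem_inversions, Finset.mem_insert, Prod.mk.injEq, Function.comp] at h ⊢
    obtain ⟨ha, hb, hab, h⟩ := h
    by_cases hlt : f b < f a
    · exact Or.inr ⟨ha, hb, hab, hlt⟩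
    · have hne : f a ≠ f b := f.injective.ne hab.ne
      have hval : f a = i ∧ f b = i + 1 := by
        by_contra hc
        exact absurd (swap_succ_lt_swap_succ (i := i) (a := f a) (b := f b) (by omega) hc)
          (by omega)
      exact Or.inl ⟨by simp [← hval.1], by simp [← hval.2]⟩
  exact (Finset.card_le_card hsub).trans (Finset.card_insert_le _ _)

/-! ### Word length and the underlying permutation of a braid -/

theorem braidGen_braid {n : ℕ} {i j : Fin (n - 1)} (h : (i : ℕ) + 1 = j) :
    braidGen n i * braidGen n j * braidGen n i = braidGen n j * braidGen n i * braidGen n j := by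
  rw [← mul_inv_eq_one]
  exact PresentedGroup.one_of_mem (rels := braidRels n) (Or.inl ⟨i, j, h, rfl⟩)

theorem braidGen_comm {n : ℕ} {i j : Fin (n - 1)} (h : (i : ℕ) + 1 < j) :
    braidGen n i * braidGen n j = braidGen n j * braidGen n i := by
  rw [← mul_inv_eq_one]
  exact PresentedGroup.one_of_mem (rels := braidRels n) (Or.inr ⟨i, j, h, rfl⟩)

/-- The exponent sum of a braid, which on positive braids is the word length. -/
def braidLengthHom (n : ℕ) : BraidGroup n →* Multiplicative ℤ :=
  PresentedGroup.toGroup (rels := braidRels n) (f := fun _ => Multiplicative.ofAdd 1) (by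
    rintro r (⟨i, j, -, rfl⟩ | ⟨i, j, -, rfl⟩) <;> simp)

/-- The exponent sum of a braid as an integer. -/
def braidLength (n : ℕ) (a : BraidGroup n) : ℤ := (braidLengthHom n a).toAdd

theorem swap_succ_braid (i : ℕ) :
    Equiv.swap i (i + 1) * Equiv.swap (i + 1) (i + 1 + 1) * Equiv.swap i (i + 1) =
      Equiv.swap (i + 1) (i + 1 + 1) * Equiv.swap i (i + 1) * Equiv.swap (i + 1) (i + 1 + 1) := by
  rw [Equiv.swap_mul_swap_mul_swap (x := i) (y := i + 1) (z := i + 1 + 1) (by omega) (by omega),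
    Equiv.swap_comm i (i + 1), Equiv.swap_comm (i + 1) (i + 1 + 1),
    Equiv.swap_mul_swap_mul_swap (by omega) (by omega), Equiv.swap_comm]

theorem swap_succ_comm {i j : ℕ} (h : i + 1 < j) :
    Equiv.swap i (i + 1) * Equiv.swap j (j + 1) = Equiv.swap j (j + 1) * Equiv.swap i (i + 1) := by
  rw [Equiv.mul_swap_eq_swap_mul, Equiv.swap_apply_of_ne_of_ne (by omega) (by omega),
    Equiv.swap_apply_of_ne_of_ne (by omega) (by omega)]

/-- The permutation of the strands, extended by the identity to all of `ℕ`. -/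
def braidPerm (n : ℕ) : BraidGroup n →* Equiv.Perm ℕ :=
  PresentedGroup.toGroup (rels := braidRels n)
    (f := fun i : Fin (n - 1) => Equiv.swap (i : ℕ) ((i : ℕ) + 1)) (by
    rintro r (⟨i, j, h, rfl⟩ | ⟨i, j, h, rfl⟩)
    · simp only [map_mul, map_inv, FreeGroup.lift_apply_of, mul_inv_eq_one, ← h]
      exact swap_succ_braid i
    · simp only [map_mul, map_inv, FreeGroup.lift_apply_of, mul_inv_eq_one]
      exact swap_succ_comm h)

section

variable {n : ℕ}

@[simp] theorem braidLength_one : braidLength n 1 = 0 := by simp [braidLength]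

@[simp] theorem braidLength_mul (a b : BraidGroup n) :
    braidLength n (a * b) = braidLength n a + braidLength n b := by simp [braidLength]

@[simp] theorem braidLength_braidGen (i : Fin (n - 1)) : braidLength n (braidGen n i) = 1 := by
  simp [braidLength, braidLengthHom, braidGen]

@[simp] theorem braidPerm_braidGen (i : Fin (n - 1)) :
    braidPerm n (braidGen n i) = Equiv.swap (i : ℕ) ((i : ℕ) + 1) := by
  simp [braidPerm, braidGen]

/-- The inverse of the permutation underlying a braid. -/
def braidPermInv (n : ℕ) (a : BraidGroup n) : Equiv.Perm ℕ := (braidPerm n a)⁻¹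

@[simp] theorem braidPermInv_one : braidPermInv n 1 = 1 := by simp [braidPermInv]

theorem braidPermInv_braidGen_mul (i : Fin (n - 1)) (a : BraidGroup n) :
    braidPermInv n (braidGen n i * a) =
      braidPermInv n a * Equiv.swap (i : ℕ) ((i : ℕ) + 1) := by
  simp [braidPermInv]

theorem braidPermInv_mul_braidGen (i : Fin (n - 1)) (a : BraidGroup n) :
    braidPermInv n (a * braidGen n i) =
      Equiv.swap (i : ℕ) ((i : ℕ) + 1) * braidPermInv n a := by
  simp [braidPermInv]

/-! ### Positive braids -/

theorem braidGen_mem (i : Fin (n - 1)) : braidGen n i ∈ PosBraid n :=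
  Submonoid.subset_closure ⟨i, rfl⟩

theorem eq_one_or_braidGen_mul {a : BraidGroup n} (ha : a ∈ PosBraid n) :
    a = 1 ∨ ∃ i, ∃ b ∈ PosBraid n, a = braidGen n i * b := by
  induction ha using Submonoid.closure_induction_left with
  | one => exact Or.inl rfl
  | mul_left x hx y hy _ =>
    obtain ⟨i, rfl⟩ := hx
    exact Or.inr ⟨i, y, hy, rfl⟩

theorem braidLength_nonneg {a : BraidGroup n} (ha : a ∈ PosBraid n) : 0 ≤ braidLength n a := by
  induction ha using Submonoid.closure_induction_left with
  | one => simp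
  | mul_left x hx y hy ih =>
    obtain ⟨i, rfl⟩ := hx
    rw [braidLength_mul, braidLength_braidGen]
    omega

theorem PrefixLE.refl (a : BraidGroup n) : PrefixLE n a a := ⟨1, one_mem _, mul_one a⟩

theorem PrefixLE.trans {a b c : BraidGroup n} : PrefixLE n a b →
    PrefixLE n b c → PrefixLE n a c := by
  rintro ⟨x, hx, rfl⟩ ⟨y, hy, rfl⟩
  exact ⟨x * y, mul_mem hx hy, (mul_assoc _ _ _).symm⟩

theorem PrefixLE.mem {a b : BraidGroup n} (ha : a ∈ PosBraid n) :
    PrefixLE n a b → b ∈ PosBraid n := by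
  rintro ⟨x, hx, rfl⟩
  exact mul_mem ha hx

theorem PrefixLE.mul_left {a b : BraidGroup n} (x : BraidGroup n) :
    PrefixLE n a b → PrefixLE n (x * a) (x * b) := by
  rintro ⟨y, hy, rfl⟩
  exact ⟨y, hy, mul_assoc _ _ _⟩

theorem PrefixLE.of_mul_left {a b x : BraidGroup n} :
    PrefixLE n (x * a) (x * b) → PrefixLE n a b := by
  rintro ⟨y, hy, h⟩
  exact ⟨y, hy, by rwa [mul_assoc, mul_right_inj] at h⟩

theorem PrefixLE.braidLength_le {a b : BraidGroup n} :
    PrefixLE n a b → braidLength n a ≤ braidLength n b := by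
  rintro ⟨y, hy, rfl⟩
  have := braidLength_nonneg hy
  rw [braidLength_mul]
  omega

/-! ### Reduced positive braids -/

theorem val_succ_lt (i : Fin (n - 1)) : (i : ℕ) + 1 < n := by omega

/-- The number of inversions of the permutation underlying a braid. -/
def braidInv (n : ℕ) (a : BraidGroup n) : ℕ := (inversions n (braidPermInv n a)).card

/-- A positive braid is reduced if its length is the inversion number of its permutation. -/
def IsReducedBraid (n : ℕ) (a : BraidGroup n) : Prop :=
  a ∈ PosBraid n ∧ braidLength n a = braidInv n a

/-- The letter `i` is a left descent of the permutation underlying `a`. -/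
def IsBraidDescent (n : ℕ) (a : BraidGroup n) (i : Fin (n - 1)) : Prop :=
  braidPermInv n a ((i : ℕ) + 1) < braidPermInv n a i

theorem braidInv_braidGen_mul_of_lt {a : BraidGroup n} {i : Fin (n - 1)}
    (h : braidPermInv n a i < braidPermInv n a ((i : ℕ) + 1)) :
    braidInv n (braidGen n i * a) = braidInv n a + 1 := by
  rw [braidInv, braidPermInv_braidGen_mul, Equiv.Perm.coe_mul,
    card_inversions_comp_swap (val_succ_lt i) h, braidInv]

theorem braidInv_braidGen_mul_of_isBraidDescent {a : BraidGroup n} {i : Fin (n - 1)}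
    (h : IsBraidDescent n a i) : braidInv n (braidGen n i * a) + 1 = braidInv n a := by
  rw [braidInv, braidPermInv_braidGen_mul, Equiv.Perm.coe_mul,
    card_inversions_comp_swap_of_gt (val_succ_lt i) h, braidInv]

theorem lt_or_isBraidDescent (a : BraidGroup n) (i : Fin (n - 1)) :
    braidPermInv n a i < braidPermInv n a ((i : ℕ) + 1) ∨ IsBraidDescent n a i :=
  lt_or_gt_of_ne ((braidPermInv n a).injective.ne (Nat.lt_succ_self _).ne)

theorem braidInv_braidGen_mul_le (a : BraidGroup n) (i : Fin (n - 1)) :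
    braidInv n (braidGen n i * a) ≤ braidInv n a + 1 := by
  rcases lt_or_isBraidDescent a i with h | h
  · exact (braidInv_braidGen_mul_of_lt h).le
  · have := braidInv_braidGen_mul_of_isBraidDescent h
    omega

theorem braidInv_mul_braidGen_le (a : BraidGroup n) (i : Fin (n - 1)) :
    braidInv n (a * braidGen n i) ≤ braidInv n a + 1 := by
  rw [braidInv, braidPermInv_mul_braidGen, Equiv.Perm.coe_mul]
  exact card_inversions_swap_comp_le n i _

theorem braidInv_mul_le_left {a : BraidGroup n} (ha : a ∈ PosBraid n) (b : BraidGroup n) :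
    (braidInv n (a * b) : ℤ) ≤ braidLength n a + braidInv n b := by
  induction ha using Submonoid.closure_induction_left with
  | one => simp
  | mul_left x hx y hy ih =>
    obtain ⟨i, rfl⟩ := hx
    have := braidInv_braidGen_mul_le (y * b) i
    rw [mul_assoc, braidLength_mul, braidLength_braidGen]
    omega

theorem braidInv_mul_le_right (a : BraidGroup n) {b : BraidGroup n} (hb : b ∈ PosBraid n) :
    (braidInv n (a * b) : ℤ) ≤ braidInv n a + braidLength n b := by
  induction hb using Submonoid.closure_induction_right with
  | one => simp
  | mul_right x hx y hy ih =>
    obtain ⟨i, rfl⟩ := hy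
    have := braidInv_mul_braidGen_le (a * x) i
    rw [← mul_assoc, braidLength_mul, braidLength_braidGen]
    omega

theorem braidInv_one : braidInv n 1 = 0 := by
  rw [braidInv, Finset.card_eq_zero, Finset.eq_empty_iff_forall_notMem]
  intro p hp
  simp only [mem_inversions, braidPermInv_one, Equiv.Perm.coe_one, id] at hp
  omega

theorem braidInv_le_braidLength {a : BraidGroup n} (ha : a ∈ PosBraid n) :
    (braidInv n a : ℤ) ≤ braidLength n a := by
  simpa [braidInv_one] using braidInv_mul_le_left ha 1

theorem isReducedBraid_one : IsReducedBraid n 1 := ⟨one_mem _, by simp [braidInv_one]⟩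

theorem IsReducedBraid.braidGen_mul {a : BraidGroup n} {i : Fin (n - 1)} (ha : IsReducedBraid n a)
    (h : braidPermInv n a i < braidPermInv n a ((i : ℕ) + 1)) :
    IsReducedBraid n (braidGen n i * a) := by
  refine ⟨mul_mem (braidGen_mem i) ha.1, ?_⟩
  rw [braidInv_braidGen_mul_of_lt h, braidLength_mul, braidLength_braidGen, ha.2]
  push_cast
  ring

theorem IsReducedBraid.of_mul_right {a b : BraidGroup n} (h : IsReducedBraid n (a * b))
    (ha : a ∈ PosBraid n) (hb : b ∈ PosBraid n) : IsReducedBraid n b := by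
  refine ⟨hb, le_antisymm ?_ (braidInv_le_braidLength hb)⟩
  have h1 := braidInv_mul_le_left ha b
  have h2 := h.2
  rw [braidLength_mul] at h2
  omega

theorem IsReducedBraid.of_mul_left {a b : BraidGroup n} (h : IsReducedBraid n (a * b))
    (ha : a ∈ PosBraid n) (hb : b ∈ PosBraid n) : IsReducedBraid n a := by
  refine ⟨ha, le_antisymm ?_ (braidInv_le_braidLength ha)⟩
  have h1 := braidInv_mul_le_right a hb
  have h2 := h.2
  rw [braidLength_mul] at h2
  omega

theorem IsReducedBraid.lt_of_braidGen_mul {a : BraidGroup n} {i : Fin (n - 1)}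
    (h : IsReducedBraid n (braidGen n i * a)) (ha : a ∈ PosBraid n) :
    braidPermInv n a i < braidPermInv n a ((i : ℕ) + 1) := by
  rcases lt_or_isBraidDescent a i with h' | h'
  · exact h'
  · have h1 := braidInv_braidGen_mul_of_isBraidDescent h'
    have h2 := (h.of_mul_right (braidGen_mem i) ha).2
    have h3 := h.2
    rw [braidLength_mul, braidLength_braidGen] at h3
    omega

theorem IsReducedBraid.isBraidDescent {a : BraidGroup n} {i : Fin (n - 1)}
    (h : IsReducedBraid n a) (hi : PrefixLE n (braidGen n i) a) : IsBraidDescent n a i := by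
  obtain ⟨b, hb, rfl⟩ := hi
  simpa [IsBraidDescent, braidPermInv_braidGen_mul] using h.lt_of_braidGen_mul hb

theorem braidPermInv_braidGen_mul_apply_of_ne (a : BraidGroup n) (i : Fin (n - 1)) {x : ℕ}
    (h1 : x ≠ i) (h2 : x ≠ (i : ℕ) + 1) :
    braidPermInv n (braidGen n i * a) x = braidPermInv n a x := by
  rw [braidPermInv_braidGen_mul, Equiv.Perm.mul_apply, Equiv.swap_apply_of_ne_of_ne h1 h2]

theorem braidPermInv_braidGen_mul_apply_left (a : BraidGroup n) (i : Fin (n - 1)) :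
    braidPermInv n (braidGen n i * a) i = braidPermInv n a ((i : ℕ) + 1) := by
  rw [braidPermInv_braidGen_mul, Equiv.Perm.mul_apply, Equiv.swap_apply_left]

theorem braidPermInv_braidGen_mul_apply_right (a : BraidGroup n) (i : Fin (n - 1)) :
    braidPermInv n (braidGen n i * a) ((i : ℕ) + 1) = braidPermInv n a i := by
  rw [braidPermInv_braidGen_mul, Equiv.Perm.mul_apply, Equiv.swap_apply_right]

/-- Descents pass to the quotient by a commuting generator. -/
theorem IsBraidDescent.of_comm {a : BraidGroup n} {i j : Fin (n - 1)}
    (h : IsBraidDescent n (braidGen n j * a) i) (hij : (i : ℕ) + 1 < j ∨ (j : ℕ) + 1 < i) :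
    IsBraidDescent n a i := by
  rwa [IsBraidDescent, braidPermInv_braidGen_mul_apply_of_ne _ _ (by omega) (by omega),
    braidPermInv_braidGen_mul_apply_of_ne _ _ (by omega) (by omega)] at h

/-- If `i` and `j` are adjacent descents of `σⱼ a`, then `i` is a descent of `a`. -/
theorem IsBraidDescent.of_adjacent {a : BraidGroup n} {i j : Fin (n - 1)}
    (hi : IsBraidDescent n (braidGen n j * a) i) (hj : IsBraidDescent n (braidGen n j * a) j)
    (hij : (i : ℕ) + 1 = j ∨ (j : ℕ) + 1 = i) : IsBraidDescent n a i := by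
  have hl := braidPermInv_braidGen_mul_apply_left a j
  have hr := braidPermInv_braidGen_mul_apply_right a j
  unfold IsBraidDescent at *
  rcases hij with h | h
  · have h1 := braidPermInv_braidGen_mul_apply_of_ne a j (x := i) (by omega) (by omega)
    rw [h] at hi ⊢
    omega
  · have h1 := braidPermInv_braidGen_mul_apply_of_ne a j (x := i + 1) (by omega) (by omega)
    rw [h] at hl hr hj
    rw [← h] at hi ⊢ h1
    rw [← h] at hl hr hj
    omega

/-- If `i` is a descent of `σⱼ σᵢ a` with `i`, `j` adjacent, then `j` is a descent of `a`. -/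
theorem IsBraidDescent.of_adjacent_mul {a : BraidGroup n} {i j : Fin (n - 1)}
    (hi : IsBraidDescent n (braidGen n j * (braidGen n i * a)) i)
    (hij : (i : ℕ) + 1 = j ∨ (j : ℕ) + 1 = i) : IsBraidDescent n a j := by
  unfold IsBraidDescent at *
  simp only [braidPermInv_braidGen_mul, Equiv.Perm.mul_apply] at hi
  rcases hij with h | h
  · have e1 : (Equiv.swap (i : ℕ) (i + 1)) ((Equiv.swap (j : ℕ) (j + 1)) i) = j := by
      simp only [Equiv.swap_apply_def]; split_ifs <;> omega
    have e2 : (Equiv.swap (i : ℕ) (i + 1)) ((Equiv.swap (j : ℕ) (j + 1)) (i + 1)) = j + 1 := by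
      simp only [Equiv.swap_apply_def]; split_ifs <;> omega
    rwa [e1, e2] at hi
  · have e1 : (Equiv.swap (i : ℕ) (i + 1)) ((Equiv.swap (j : ℕ) (j + 1)) i) = j := by
      simp only [Equiv.swap_apply_def]; split_ifs <;> omega
    have e2 : (Equiv.swap (i : ℕ) (i + 1)) ((Equiv.swap (j : ℕ) (j + 1)) (i + 1)) = j + 1 := by
      simp only [Equiv.swap_apply_def]; split_ifs <;> omega
    rwa [e1, e2] at hi

theorem braidGen_braid_of_adjacent {i j : Fin (n - 1)} (h : (i : ℕ) + 1 = j ∨ (j : ℕ) + 1 = i) :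
    braidGen n i * braidGen n j * braidGen n i = braidGen n j * braidGen n i * braidGen n j :=
  h.elim braidGen_braid fun h => (braidGen_braid h).symm

theorem braidGen_comm_of_far {i j : Fin (n - 1)} (h : (i : ℕ) + 1 < j ∨ (j : ℕ) + 1 < i) :
    braidGen n i * braidGen n j = braidGen n j * braidGen n i :=
  h.elim braidGen_comm fun h => (braidGen_comm h).symm

theorem fin_trichotomy (i j : Fin (n - 1)) : i = j ∨ ((i : ℕ) + 1 = j ∨ (j : ℕ) + 1 = i) ∨
    ((i : ℕ) + 1 < j ∨ (j : ℕ) + 1 < i) := by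
  rw [Fin.ext_iff]
  omega

/-- The descents of the permutation of a reduced braid are the generators dividing it. -/
theorem IsReducedBraid.prefixLE_of_isBraidDescent {a : BraidGroup n} (ha : IsReducedBraid n a)
    {i : Fin (n - 1)} (hi : IsBraidDescent n a i) : PrefixLE n (braidGen n i) a := by
  obtain ⟨N, hN⟩ : ∃ N : ℕ, braidLength n a ≤ N := ⟨_, ha.2.le⟩
  induction N using Nat.strong_induction_on generalizing a i with
  | _ N ih =>
  obtain rfl | ⟨j, b, hb, rfl⟩ := eq_one_or_braidGen_mul ha.1
  · simp [IsBraidDescent] at hi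
  have hbr := ha.of_mul_right (braidGen_mem j) hb
  have hbpos := braidLength_nonneg hb
  rw [braidLength_mul, braidLength_braidGen] at hN
  obtain rfl | hij | hij := fin_trichotomy i j
  · exact ⟨b, hb, rfl⟩
  · obtain ⟨c, hc, rfl⟩ := ih (N - 1) (by omega) hbr
      (hi.of_adjacent (ha.isBraidDescent ⟨b, hb, rfl⟩) hij) (by omega)
    have hcr := hbr.of_mul_right (braidGen_mem i) hc
    have hcpos := braidLength_nonneg hc
    rw [braidLength_mul, braidLength_braidGen] at hN
    obtain ⟨d, hd, rfl⟩ := ih (N - 2) (by omega) hcr (hi.of_adjacent_mul hij) (by omega)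
    refine ⟨braidGen n j * braidGen n i * d,
      mul_mem (mul_mem (braidGen_mem j) (braidGen_mem i)) hd, ?_⟩
    simp only [← mul_assoc]
    rw [braidGen_braid_of_adjacent hij]
  · obtain ⟨c, hc, rfl⟩ := ih (N - 1) (by omega) hbr (hi.of_comm hij) (by omega)
    refine ⟨braidGen n j * c, mul_mem (braidGen_mem j) hc, ?_⟩
    rw [← mul_assoc, ← mul_assoc, braidGen_comm_of_far hij]

/-- Two generators have a common right-multiple that divides every reduced braid they divide. -/
theorem exists_braidGen_lcm (i j : Fin (n - 1)) :
    ∃ m ∈ PosBraid n, PrefixLE n (braidGen n i) m ∧ PrefixLE n (braidGen n j) m ∧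
      ∀ a, IsReducedBraid n a → PrefixLE n (braidGen n i) a → PrefixLE n (braidGen n j) a →
        PrefixLE n m a := by
  obtain rfl | hij | hij := fin_trichotomy i j
  · exact ⟨_, braidGen_mem i, .refl _, .refl _, fun a _ h _ => h⟩
  · refine ⟨braidGen n j * (braidGen n i * braidGen n j),
      mul_mem (braidGen_mem j) (mul_mem (braidGen_mem i) (braidGen_mem j)),
      ⟨braidGen n j * braidGen n i, mul_mem (braidGen_mem j) (braidGen_mem i), ?_⟩,
      ⟨_, mul_mem (braidGen_mem i) (braidGen_mem j), rfl⟩, ?_⟩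
    · rw [← mul_assoc, ← mul_assoc, braidGen_braid_of_adjacent hij]
    · rintro a ha hi hj
      have hid := ha.isBraidDescent hi
      have hjd := ha.isBraidDescent hj
      obtain ⟨b, hb, rfl⟩ := hj
      have hbr := ha.of_mul_right (braidGen_mem j) hb
      obtain ⟨c, hc, rfl⟩ := hbr.prefixLE_of_isBraidDescent (hid.of_adjacent hjd hij)
      have hcr := hbr.of_mul_right (braidGen_mem i) hc
      exact ((hcr.prefixLE_of_isBraidDescent (hid.of_adjacent_mul hij)).mul_left _).mul_left _
  · refine ⟨braidGen n j * braidGen n i, mul_mem (braidGen_mem j) (braidGen_mem i),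
      ⟨_, braidGen_mem j, braidGen_comm_of_far hij⟩, ⟨_, braidGen_mem i, rfl⟩, ?_⟩
    rintro a ha hi hj
    have hid := ha.isBraidDescent hi
    obtain ⟨b, hb, rfl⟩ := hj
    have hbr := ha.of_mul_right (braidGen_mem j) hb
    exact (hbr.prefixLE_of_isBraidDescent (hid.of_comm hij)).mul_left _

/-! ### Simple braids are reduced -/

/-- The braid generators indexed by `ℕ`, trivial outside the range of indices. -/
def natBraidGen (n k : ℕ) : BraidGroup n := if h : k < n - 1 then braidGen n ⟨k, h⟩ else 1

/-- The product `σ_{t-1} ⋯ σ₁ σ₀`. -/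
def descendingBraid (n t : ℕ) : BraidGroup n := ((List.range t).reverse.map (natBraidGen n)).prod

theorem descendingBraid_succ (t : ℕ) :
    descendingBraid n (t + 1) = natBraidGen n t * descendingBraid n t := by
  simp [descendingBraid, List.range_succ]

theorem filter_le_range {N k : ℕ} (hk : k < N) :
    (List.range N).filter (fun i => decide (i ≤ k)) = List.range (k + 1) := by
  obtain ⟨d, rfl⟩ := Nat.exists_eq_add_of_le (Nat.succ_le_of_lt hk)
  rw [List.range_add, List.filter_append, List.filter_eq_self.2, List.filter_eq_nil_iff.2,
    List.append_nil]
  · simp only [List.mem_map, List.mem_range, decide_eq_true_eq]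
    omega
  · simp

theorem braidDelta_eq :
    braidDelta n = ((List.range (n - 1)).map (fun k => descendingBraid n (k + 1))).prod := by
  have hgen : braidGen n = natBraidGen n ∘ Fin.val := by
    ext i
    simp [natBraidGen]
  rw [braidDelta, ← List.map_coe_finRange_eq_range, List.map_map]
  congr 2
  ext k
  rw [Function.comp_apply, descendingBraid, ← filter_le_range k.2, hgen, ← List.map_map,
    List.map_reverse, ← List.map_coe_finRange_eq_range, List.filter_map]
  rfl

theorem IsReducedBraid.descendingBraid_mul {b : BraidGroup n} (hb : IsReducedBraid n b) {m : ℕ}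
    (hm : m < n) (hmono : ∀ x, 0 < x → x ≤ m → braidPermInv n b 0 < braidPermInv n b x) (t : ℕ)
    (ht : t ≤ m) :
    IsReducedBraid n (descendingBraid n t * b) ∧
      (∀ x < t, braidPermInv n (descendingBraid n t * b) x = braidPermInv n b (x + 1)) ∧
      braidPermInv n (descendingBraid n t * b) t = braidPermInv n b 0 ∧
      ∀ x > t, braidPermInv n (descendingBraid n t * b) x = braidPermInv n b x := by
  induction t with
  | zero => simpa [descendingBraid] using hb
  | succ t ih =>
    obtain ⟨h1, h2, h3, h4⟩ := ih (by omega)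
    have hlt : t < n - 1 := by omega
    rw [descendingBraid_succ, natBraidGen, dif_pos hlt, mul_assoc]
    refine ⟨h1.braidGen_mul ?_, ?_, ?_, ?_⟩
    · rw [h3, h4 _ (Nat.lt_succ_self t)]
      exact hmono _ t.succ_pos ht
    · intro x hx
      obtain rfl | hx' := eq_or_ne x t
      · exact (braidPermInv_braidGen_mul_apply_left _ ⟨x, hlt⟩).trans (h4 _ (Nat.lt_succ_self x))
      · rw [braidPermInv_braidGen_mul_apply_of_ne _ _ hx' (by simp only; omega), h2 _ (by omega)]
    · exact (braidPermInv_braidGen_mul_apply_right _ ⟨t, hlt⟩).trans h3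
    · intro x hx
      rw [braidPermInv_braidGen_mul_apply_of_ne _ _ (by simp only; omega) (by simp only; omega),
        h4 _ (by omega)]

theorem IsReducedBraid.prod_descendingBraid_mul {m : ℕ} (hm : m < n) {b : BraidGroup n}
    (hb : IsReducedBraid n b)
    (hmono : ∀ x y, x < y → y ≤ m → braidPermInv n b x < braidPermInv n b y) :
    IsReducedBraid n
      (((List.range m).map (fun k => descendingBraid n (k + 1))).prod * b) := by
  induction m generalizing b with
  | zero => simpa using hb
  | succ m ih =>
    obtain ⟨h1, h2, -⟩ :=
      hb.descendingBraid_mul hm (fun x hx hxm => hmono 0 x hx hxm) (m + 1) le_rfl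
    rw [List.range_succ, List.map_append, List.prod_append, List.map_singleton,
      List.prod_singleton, mul_assoc]
    refine ih (by omega) h1 fun x y hxy hy => ?_
    rw [h2 x (by omega), h2 y (by omega)]
    exact hmono _ _ (by omega) (by omega)

theorem isReducedBraid_braidDelta (hn : n ≠ 0) : IsReducedBraid n (braidDelta n) := by
  rw [braidDelta_eq, ← mul_one (List.prod _)]
  exact isReducedBraid_one.prod_descendingBraid_mul (by omega) (by simp +contextual)

theorem IsSimple.isReducedBraid (hn : n ≠ 0) {s : BraidGroup n} (hs : IsSimple n s) :
    IsReducedBraid n s := by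
  obtain ⟨hpos, c, hc, h⟩ := hs
  exact (h ▸ isReducedBraid_braidDelta hn).of_mul_left hpos hc

/-! ### Greatest common divisors -/

/-- Common divisors of two reduced braids lying above a given one have a maximum. -/
theorem exists_max_common_divisor {s t : BraidGroup n} (hs : IsReducedBraid n s)
    (ht : IsReducedBraid n t) {x : BraidGroup n} (hx : x ∈ PosBraid n) (hxs : PrefixLE n x s)
    (hxt : PrefixLE n x t) :
    ∃ m, PrefixLE n x m ∧ PrefixLE n m s ∧ PrefixLE n m t ∧
      ∀ y, PrefixLE n x y → PrefixLE n y s → PrefixLE n y t → PrefixLE n y m := by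
  obtain ⟨N, hN⟩ : ∃ N : ℕ, braidLength n s - braidLength n x < N :=
    ⟨(braidLength n s - braidLength n x).toNat + 1, by omega⟩
  induction N generalizing x with
  | zero =>
    have := hxs.braidLength_le
    omega
  | succ N ih =>
    have hle_gen {y : BraidGroup n} (hxy : PrefixLE n x y) :
        y = x ∨ ∃ i, PrefixLE n (x * braidGen n i) y := by
      obtain ⟨c, hc, rfl⟩ := hxy
      obtain rfl | ⟨i, d, hd, rfl⟩ := eq_one_or_braidGen_mul hc
      · exact Or.inl (mul_one x)
      · exact Or.inr ⟨i, d, hd, mul_assoc _ _ _⟩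
    have hx_le (i) : PrefixLE n x (x * braidGen n i) := ⟨_, braidGen_mem i, rfl⟩
    have hmax (i) (his : PrefixLE n (x * braidGen n i) s) (hit : PrefixLE n (x * braidGen n i) t) :=
      ih (mul_mem hx (braidGen_mem i)) his hit
        (by rw [braidLength_mul, braidLength_braidGen]; omega)
    by_cases hex : ∃ i, PrefixLE n (x * braidGen n i) s ∧ PrefixLE n (x * braidGen n i) t
    · obtain ⟨i, his, hit⟩ := hex
      obtain ⟨m, him, hms, hmt, hm⟩ := hmax i his hit
      refine ⟨m, (hx_le i).trans him, hms, hmt, fun y hxy hys hyt => ?_⟩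
      obtain rfl | ⟨j, hjy⟩ := hle_gen hxy
      · exact (hx_le i).trans him
      have hjs := hjy.trans hys
      have hjt := hjy.trans hyt
      obtain ⟨m', hjm', hms', hmt', hm'⟩ := hmax j hjs hjt
      obtain ⟨l, -, hil, hjl, hl⟩ := exists_braidGen_lcm i j
      have hl_le {u : BraidGroup n} (hu : IsReducedBraid n u) (hxu : PrefixLE n x u)
          (hiu : PrefixLE n (x * braidGen n i) u) (hju : PrefixLE n (x * braidGen n j) u) :
          PrefixLE n (x * l) u := by
        obtain ⟨c, hc, rfl⟩ := hxu
        exact (hl c (hu.of_mul_right hx hc) hiu.of_mul_left hju.of_mul_left).mul_left x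
      have hls := hl_le hs hxs his hjs
      have hlt := hl_le ht hxt hit hjt
      have hlm' := hm' _ (hjl.mul_left x) hls hlt
      exact (hm' y hjy hys hyt).trans (hm m' ((hil.mul_left x).trans hlm') hms' hmt')
    · refine ⟨x, .refl x, hxs, hxt, fun y hxy hys hyt => ?_⟩
      obtain rfl | ⟨i, hi⟩ := hle_gen hxy
      · exact .refl y
      · exact absurd ⟨i, hi.trans hys, hi.trans hyt⟩ hex

theorem IsReducedBraid.exists_isGCD {s t : BraidGroup n} (hs : IsReducedBraid n s)
    (ht : IsReducedBraid n t) : ∃ d, IsGCD n s t d := by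
  have hone {a : BraidGroup n} (ha : a ∈ PosBraid n) : PrefixLE n 1 a := ⟨a, ha, one_mul a⟩
  obtain ⟨d, h1, hds, hdt, hd⟩ :=
    exists_max_common_divisor hs ht (one_mem _) (hone hs.1) (hone ht.1)
  exact ⟨d, h1.mem (one_mem _), hds, hdt, fun c hc => hd c (hone hc)⟩

theorem PrefixLE.ne_one {a : BraidGroup n} {i : Fin (n - 1)} (h : PrefixLE n (braidGen n i) a) :
    a ≠ 1 := by
  rintro rfl
  have := h.braidLength_le
  simp at this

end

/-- if a set `T` of simple elements is closed under greatest common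
left-divisors, then the set of ≼-minimal elements of `T \ {1}` has at most `n - 1`
elements. -/
theorem stmt4 (n : ℕ) (hn : 2 ≤ n) (T : Set (BraidGroup n))
    (hT : ∀ s ∈ T, IsSimple n s)
    (hgcd : ∀ s₁ ∈ T, ∀ s₂ ∈ T, ∀ d, IsGCD n s₁ s₂ d → d ∈ T) :
    {s | s ∈ T ∧ s ≠ 1 ∧ ∀ t ∈ T, t ≠ 1 → PrefixLE n t s → t = s}.Finite ∧
    {s | s ∈ T ∧ s ≠ 1 ∧ ∀ t ∈ T, t ≠ 1 → PrefixLE n t s → t = s}.ncard ≤ n - 1 := by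
  have hgenLE : ∀ s ∈ {s | s ∈ T ∧ s ≠ 1 ∧ ∀ t ∈ T, t ≠ 1 → PrefixLE n t s → t = s},
      ∃ i, PrefixLE n (braidGen n i) s := by
    rintro s ⟨hsT, hs1, -⟩
    obtain h | ⟨i, b, hb, h⟩ := eq_one_or_braidGen_mul (hT s hsT).1
    · exact absurd h hs1
    · exact ⟨i, b, hb, h.symm⟩
  have : Nonempty (Fin (n - 1)) := ⟨⟨0, by omega⟩⟩
  choose! φ hφ using hgenLE
  have hinj : Set.InjOn φ {s | s ∈ T ∧ s ≠ 1 ∧ ∀ t ∈ T, t ≠ 1 → PrefixLE n t s → t = s} := by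
    intro s hs t ht hst
    obtain ⟨d, hd⟩ := ((hT s hs.1).isReducedBraid (by omega)).exists_isGCD
      ((hT t ht.1).isReducedBraid (by omega))
    have hdT := hgcd s hs.1 t ht.1 d hd
    have hd1 : d ≠ 1 :=
      (hd.2.2.2 _ (braidGen_mem (φ s)) (hφ s hs) (hst ▸ hφ t ht)).ne_one
    rw [← hs.2.2 d hdT hd1 hd.2.1, ← ht.2.2 d hdT hd1 hd.2.2.1]
  refine ⟨Set.Finite.of_injOn (Set.mapsTo_univ φ _) hinj Set.finite_univ, ?_⟩
  simpa [Set.ncard_univ] using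
    Set.ncard_le_ncard_of_injOn φ (fun _ _ => Set.mem_univ _) hinj Set.finite_univ
end
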